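/- Let A be a nonempty finite subset of a connected closed orientable (n+1)-manifold N. Then the n-th Betti number of N ∖ A equals β_n(N) + |A| - 1. -/

import Mathlib

open CategoryTheory AlgebraicTopology

/-- The singular chain complex of a topological space with rational
coefficients. -/
noncomputable def singularChainComplex : TopCat ⥤ ChainComplex (ModuleCat ℚ) ℕ :=
  TopCat.toSSet ⋙
    ((SimplicialObject.whiskering _ _).obj (ModuleCat.free ℚ)) ⋙
      alternatingFaceMapComplex (ModuleCat ℚ)

/-- The `k`-th singular homology of a topological space with rational
coefficients. -/
noncomputable def singularHomology (X : TopCat) (k : ℕ) : ModuleCat ℚ :=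
  (singularChainComplex.obj X).homology k

/-- The `k`-th Betti number of a topological space. -/
noncomputable def bettiNumber (X : TopCat) (k : ℕ) : ℕ :=
  Module.finrank ℚ (singularHomology X k)

namespace SingularChains

/-- The standard topological simplex of dimension `n`. -/
abbrev Simp (n : ℕ) : Type := stdSimplex ℝ (Fin (n + 1))

/-- Singular simplices of all dimensions in `X`. -/
abbrev SingularSimplex (X : Type*) [TopologicalSpace X] := Σ k : ℕ, C(Simp k, X)

/-- Rational singular chains of all degrees in `X`. -/
abbrev Chains (X : Type*) [TopologicalSpace X] := SingularSimplex X →₀ ℚ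

/-- The affine map of simplices sending the `i`-th vertex to `v i`. -/
noncomputable def affine {k n : ℕ} (v : Fin (k + 1) → Simp n) : C(Simp k, Simp n) where
  toFun t := ⟨fun j => ∑ i, t i * v i j, fun j => Finset.sum_nonneg fun i _ =>
      mul_nonneg (t.2.1 i) ((v i).2.1 j), by
    rw [Finset.sum_comm]
    simp [← Finset.mul_sum]⟩
  continuous_toFun := by
    refine Continuous.subtype_mk (continuous_pi fun j => continuous_finsetSum _ fun i _ => ?_) _
    exact ((continuous_apply i).comp continuous_subtype_val).mul continuous_const

lemma affine_apply {k n : ℕ} (v : Fin (k + 1) → Simp n) (t : Simp k) (j : Fin (n + 1)) :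
    affine v t j = ∑ i, t i * v i j := rfl

lemma affine_coe {k n : ℕ} (v : Fin (k + 1) → Simp n) (t : Simp k) :
    (affine v t : Fin (n + 1) → ℝ) = ∑ i, t i • (v i : Fin (n + 1) → ℝ) := by
  ext j
  rw [affine_apply]
  simp

lemma affine_vertex {k n : ℕ} (v : Fin (k + 1) → Simp n) (i : Fin (k + 1)) :
    affine v (stdSimplex.vertex i) = v i := by
  ext j
  simp [affine_apply, Pi.single_apply]

lemma affine_affine {k m n : ℕ} (w : Fin (m + 1) → Simp n) (v : Fin (k + 1) → Simp m)
    (t : Simp k) : affine w (affine v t) = affine (fun i => affine w (v i)) t := by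
  ext j
  simp only [affine_apply, Finset.sum_mul, Finset.mul_sum]
  rw [Finset.sum_comm]
  simp only [mul_assoc]

lemma affine_comp_affine {k m n : ℕ} (w : Fin (m + 1) → Simp n) (v : Fin (k + 1) → Simp m) :
    (affine w).comp (affine v) = affine (fun i => affine w (v i)) :=
  ContinuousMap.ext fun t => affine_affine w v t

lemma affine_vertices (k : ℕ) :
    affine (fun i : Fin (k + 1) => stdSimplex.vertex (S := ℝ) i) = ContinuousMap.id (Simp k) := by
  ext t j
  simp [affine_apply, Pi.single_apply]

/-- The `i`-th face inclusion. -/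
noncomputable def face {k : ℕ} (i : Fin (k + 2)) : C(Simp k, Simp (k + 1)) :=
  affine fun j => stdSimplex.vertex (i.succAbove j)

lemma affine_comp_face {k n : ℕ} (v : Fin (k + 2) → Simp n) (i : Fin (k + 2)) :
    (affine v).comp (face i) = affine (fun j => v (i.succAbove j)) := by
  simp only [face, affine_comp_affine, affine_vertex]

section Chains

variable {X Y Z : Type*} [TopologicalSpace X] [TopologicalSpace Y] [TopologicalSpace Z]

/-- The boundary of a singular simplex. -/
noncomputable def simplexBoundary : SingularSimplex X → Chains X
  | ⟨0, _⟩ => 0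
  | ⟨k + 1, σ⟩ => ∑ i : Fin (k + 2), (-1 : ℚ) ^ (i : ℕ) • Finsupp.single ⟨k, σ.comp (face i)⟩ 1

/-- The boundary operator on singular chains. -/
noncomputable def bd : Chains X →ₗ[ℚ] Chains X := Finsupp.linearCombination ℚ simplexBoundary

/-- The map on chains induced by a continuous map. -/
noncomputable def push (f : C(X, Y)) : Chains X →ₗ[ℚ] Chains Y :=
  Finsupp.lmapDomain ℚ ℚ fun s => ⟨s.1, f.comp s.2⟩

@[simp] lemma push_single (f : C(X, Y)) (s : SingularSimplex X) (q : ℚ) :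
    push f (Finsupp.single s q) = Finsupp.single ⟨s.1, f.comp s.2⟩ q := by
  simp [push]

@[simp] lemma bd_single (s : SingularSimplex X) : bd (Finsupp.single s 1) = simplexBoundary s := by
  simp [bd]

lemma bd_push (f : C(X, Y)) (c : Chains X) : bd (push f c) = push f (bd c) := by
  suffices bd ∘ₗ push f = push f ∘ₗ bd from LinearMap.congr_fun this c
  refine Finsupp.lhom_ext' fun s => LinearMap.ext_ring ?_
  obtain ⟨_ | k, σ⟩ := s <;> simp [simplexBoundary, ContinuousMap.comp_assoc]

end Chains

/-- Formal chains of affine simplices in a standard simplex, an affine simplex being given by the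
list of its vertices. The empty list plays the role of the augmentation. -/
abbrev AffineChains (n : ℕ) := List (Simp n) →₀ ℚ

namespace AffineChains

variable {n m : ℕ}

/-- The cone with apex `v`. -/
noncomputable def cone (v : Simp n) : AffineChains n →ₗ[ℚ] AffineChains n :=
  Finsupp.lmapDomain ℚ ℚ (List.cons v)

@[simp] lemma cone_single (v : Simp n) (l : List (Simp n)) (q : ℚ) :
    cone v (Finsupp.single l q) = Finsupp.single (v :: l) q := by
  simp [cone]

/-- The boundary of an affine simplex. -/
noncomputable def listBoundary : List (Simp n) → AffineChains n
  | [] => 0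
  | v :: l => Finsupp.single l 1 - cone v (listBoundary l)

/-- The (augmented) boundary operator on affine chains. -/
noncomputable def bd : AffineChains n →ₗ[ℚ] AffineChains n :=
  Finsupp.linearCombination ℚ listBoundary

@[simp] lemma bd_single (l : List (Simp n)) : bd (Finsupp.single l 1) = listBoundary l := by
  simp [bd]

lemma bd_cone (v : Simp n) (c : AffineChains n) : bd (cone v c) = c - cone v (bd c) := by
  suffices bd ∘ₗ cone v = LinearMap.id - cone v ∘ₗ bd from LinearMap.congr_fun this c
  refine Finsupp.lhom_ext' fun s => LinearMap.ext_ring ?_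
  simp [listBoundary]

lemma bd_listBoundary (l : List (Simp n)) : bd (listBoundary l) = 0 := by
  induction l with
  | nil => simp [listBoundary]
  | cons v l ih => simp [listBoundary, bd_cone, ih]

lemma bd_bd (c : AffineChains n) : bd (bd c) = 0 := by
  suffices bd ∘ₗ bd = (0 : AffineChains n →ₗ[ℚ] AffineChains n) from LinearMap.congr_fun this c
  refine Finsupp.lhom_ext' fun s => LinearMap.ext_ring ?_
  simp [bd_listBoundary]

lemma listBoundary_eq_sum (l : List (Simp n)) :
    listBoundary l = ∑ i : Fin l.length, (-1 : ℚ) ^ (i : ℕ) • Finsupp.single (l.eraseIdx i) 1 := by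
  induction l with
  | nil => simp [listBoundary]
  | cons v l ih =>
    simp [listBoundary, ih, Fin.sum_univ_succ, pow_succ, sub_eq_add_neg]

/-- The barycenter of an affine simplex. -/
noncomputable def bary : List (Simp n) → Simp n
  | [] => stdSimplex.vertex 0
  | a :: t => affine (fun i : Fin (t.length + 1) => (a :: t).get i) stdSimplex.barycenter

/-- The barycentric subdivision of an affine simplex. -/
noncomputable def listSd : List (Simp n) → AffineChains n
  | [] => Finsupp.single [] 1
  | a :: t => cone (bary (a :: t))
      (∑ i : Fin (t.length + 1), (-1 : ℚ) ^ (i : ℕ) • listSd ((a :: t).eraseIdx i))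
termination_by l => l.length
decreasing_by
  have := i.2
  grind [List.length_eraseIdx]

/-- The barycentric subdivision operator. -/
noncomputable def sd : AffineChains n →ₗ[ℚ] AffineChains n :=
  Finsupp.linearCombination ℚ listSd

@[simp] lemma sd_single (l : List (Simp n)) : sd (Finsupp.single l 1) = listSd l := by
  simp [sd]

lemma listSd_cons (a : Simp n) (t : List (Simp n)) :
    listSd (a :: t) = cone (bary (a :: t)) (sd (listBoundary (a :: t))) := by
  rw [listSd, listBoundary_eq_sum]
  simp only [map_sum, map_smul, sd_single, List.length_cons]

/-- The chain homotopy between the identity and subdivision, on an affine simplex. -/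
noncomputable def listHtpy : List (Simp n) → AffineChains n
  | [] => 0
  | a :: t => cone (bary (a :: t)) (Finsupp.single (a :: t) 1 - listSd (a :: t) -
      ∑ i : Fin (t.length + 1), (-1 : ℚ) ^ (i : ℕ) • listHtpy ((a :: t).eraseIdx i))
termination_by l => l.length
decreasing_by
  have := i.2
  grind [List.length_eraseIdx]

/-- The chain homotopy between the identity and subdivision. -/
noncomputable def htpy : AffineChains n →ₗ[ℚ] AffineChains n :=
  Finsupp.linearCombination ℚ listHtpy

@[simp] lemma htpy_single (l : List (Simp n)) : htpy (Finsupp.single l 1) = listHtpy l := by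
  simp [htpy]

lemma listHtpy_cons (a : Simp n) (t : List (Simp n)) :
    listHtpy (a :: t) = cone (bary (a :: t)) (Finsupp.single (a :: t) 1 - listSd (a :: t) -
      htpy (listBoundary (a :: t))) := by
  rw [listHtpy, listBoundary_eq_sum]
  simp only [map_sum, map_smul, htpy_single, List.length_cons]

lemma listBoundary_induction {P : List (Simp n) → Prop} (nil : P [])
    (cons : ∀ a t, (∀ i : Fin (t.length + 1), P ((a :: t).eraseIdx i)) → P (a :: t)) (l) : P l := by
  induction h : l.length generalizing l with
  | zero => rwa [List.length_eq_zero_iff.1 h]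
  | succ k ih =>
    obtain _ | ⟨a, t⟩ := l
    · exact nil
    · exact cons a t fun i => ih _ (by
        have := i.2
        grind [List.length_eraseIdx])

lemma eq_on_listBoundary {M : Type*} [AddCommGroup M] [Module ℚ M]
    {f g : AffineChains n →ₗ[ℚ] M} {a : Simp n} {t : List (Simp n)}
    (h : ∀ i : Fin (t.length + 1), f (Finsupp.single ((a :: t).eraseIdx i) 1) =
      g (Finsupp.single ((a :: t).eraseIdx i) 1)) :
    f (listBoundary (a :: t)) = g (listBoundary (a :: t)) := by
  rw [listBoundary_eq_sum]
  simp only [map_sum, map_smul]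
  exact Finset.sum_congr rfl fun i _ => by rw [h i]

lemma bd_sd (c : AffineChains n) : bd (sd c) = sd (bd c) := by
  suffices bd ∘ₗ sd = sd ∘ₗ (bd : AffineChains n →ₗ[ℚ] AffineChains n) from
    LinearMap.congr_fun this c
  refine Finsupp.lhom_ext' fun s => LinearMap.ext_ring ?_
  simp only [LinearMap.comp_apply, Finsupp.lsingle_apply]
  induction s using listBoundary_induction with
  | nil => simp [listSd, listBoundary]
  | cons a t ih =>
    have h := eq_on_listBoundary (f := bd ∘ₗ sd) (g := sd ∘ₗ bd) ih
    simp only [LinearMap.comp_apply, bd_listBoundary, map_zero] at h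
    rw [sd_single, listSd_cons, bd_cone, h, map_zero, sub_zero, bd_single]

lemma bd_htpy (c : AffineChains n) : bd (htpy c) + htpy (bd c) = c - sd c := by
  suffices bd ∘ₗ htpy + htpy ∘ₗ bd = LinearMap.id - (sd : AffineChains n →ₗ[ℚ] AffineChains n) from
    LinearMap.congr_fun this c
  refine Finsupp.lhom_ext' fun s => LinearMap.ext_ring ?_
  simp only [LinearMap.comp_apply, Finsupp.lsingle_apply]
  induction s using listBoundary_induction with
  | nil => simp [listSd, listBoundary, listHtpy]
  | cons a t ih =>
    have h := eq_on_listBoundary (f := bd ∘ₗ htpy + htpy ∘ₗ bd) (g := LinearMap.id - sd) ih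
    simp only [LinearMap.add_apply, LinearMap.sub_apply, LinearMap.id_apply,
      LinearMap.comp_apply, bd_listBoundary, map_zero, add_zero] at h ⊢
    rw [htpy_single, listHtpy_cons, bd_cone]
    have e : bd (Finsupp.single (a :: t) 1 - listSd (a :: t) - htpy (listBoundary (a :: t))) = 0 := by
      rw [map_sub, map_sub, h, bd_single, ← sd_single, bd_sd, bd_single, sub_self]
    rw [e, map_zero, bd_single, sd_single]
    abel

/-- The map on affine chains induced by an affine map of simplices. -/
noncomputable def push (w : Fin (m + 1) → Simp n) : AffineChains m →ₗ[ℚ] AffineChains n :=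
  Finsupp.lmapDomain ℚ ℚ (List.map (affine w))

@[simp] lemma push_single (w : Fin (m + 1) → Simp n) (l : List (Simp m)) (q : ℚ) :
    push w (Finsupp.single l q) = Finsupp.single (l.map (affine w)) q := by
  simp [push]

lemma push_cone (w : Fin (m + 1) → Simp n) (v : Simp m) (c : AffineChains m) :
    push w (cone v c) = cone (affine w v) (push w c) := by
  suffices push w ∘ₗ cone v = cone (affine w v) ∘ₗ push w from LinearMap.congr_fun this c
  refine Finsupp.lhom_ext' fun s => LinearMap.ext_ring ?_
  simp

lemma push_listBoundary (w : Fin (m + 1) → Simp n) (l : List (Simp m)) :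
    push w (listBoundary l) = listBoundary (l.map (affine w)) := by
  induction l with
  | nil => simp [listBoundary]
  | cons v l ih => simp [listBoundary, push_cone, ih]

lemma bary_eq (l : List (Simp n)) (k : ℕ) (h : l.length = k + 1) :
    bary l = affine (fun i : Fin (k + 1) => l.get (i.cast h.symm)) stdSimplex.barycenter := by
  obtain _ | ⟨a, t⟩ := l
  · simp at h
  · obtain rfl : t.length = k := by simpa using h
    rfl

lemma bary_map (w : Fin (m + 1) → Simp n) (a : Simp m) (t : List (Simp m)) :
    bary ((a :: t).map (affine w)) = affine w (bary (a :: t)) := by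
  rw [bary_eq _ t.length (by simp), bary_eq (a :: t) t.length (by simp), affine_affine]
  simp only [List.get_eq_getElem, List.getElem_map, Fin.val_cast]

lemma push_sd (w : Fin (m + 1) → Simp n) (c : AffineChains m) : push w (sd c) = sd (push w c) := by
  suffices push w ∘ₗ sd = sd ∘ₗ push w from LinearMap.congr_fun this c
  refine Finsupp.lhom_ext' fun s => LinearMap.ext_ring ?_
  simp only [LinearMap.comp_apply, Finsupp.lsingle_apply]
  induction s using listBoundary_induction with
  | nil => simp [listSd]
  | cons a t ih =>
    have h := eq_on_listBoundary (f := push w ∘ₗ sd) (g := sd ∘ₗ push w) ih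
    simp only [LinearMap.comp_apply] at h
    rw [sd_single, listSd_cons, push_cone, h, push_listBoundary, push_single, sd_single,
      ← bary_map, List.map_cons, listSd_cons]

lemma push_htpy (w : Fin (m + 1) → Simp n) (c : AffineChains m) :
    push w (htpy c) = htpy (push w c) := by
  suffices push w ∘ₗ htpy = htpy ∘ₗ push w from LinearMap.congr_fun this c
  refine Finsupp.lhom_ext' fun s => LinearMap.ext_ring ?_
  simp only [LinearMap.comp_apply, Finsupp.lsingle_apply]
  induction s using listBoundary_induction with
  | nil => simp [listHtpy]
  | cons a t ih =>
    have h := eq_on_listBoundary (f := push w ∘ₗ htpy) (g := htpy ∘ₗ push w) ih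
    simp only [LinearMap.comp_apply] at h
    rw [htpy_single, listHtpy_cons, push_cone, map_sub (push w), map_sub (push w), h, ← sd_single,
      push_sd, push_listBoundary, push_single, sd_single, htpy_single, ← bary_map, List.map_cons,
      listHtpy_cons]

end AffineChains

section Realization

variable {X Y : Type*} [TopologicalSpace X] [TopologicalSpace Y] {n m : ℕ}

/-- The singular simplex obtained by restricting `σ` to an affine simplex. -/
noncomputable def listRealize (σ : C(Simp n, X)) : List (Simp n) → Chains X
  | [] => 0
  | a :: t => Finsupp.single
      ⟨t.length, σ.comp (affine fun i : Fin (t.length + 1) => (a :: t).get i)⟩ 1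

/-- The singular chain obtained by restricting `σ` to an affine chain. -/
noncomputable def realize (σ : C(Simp n, X)) : AffineChains n →ₗ[ℚ] Chains X :=
  Finsupp.linearCombination ℚ (listRealize σ)

@[simp] lemma realize_single (σ : C(Simp n, X)) (l : List (Simp n)) :
    realize σ (Finsupp.single l 1) = listRealize σ l := by
  simp [realize]

lemma listRealize_eq (σ : C(Simp n, X)) (l : List (Simp n)) (k : ℕ) (h : l.length = k + 1) :
    listRealize σ l =
      Finsupp.single ⟨k, σ.comp (affine fun i : Fin (k + 1) => l.get (i.cast h.symm))⟩ 1 := by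
  obtain _ | ⟨a, t⟩ := l
  · simp at h
  · obtain rfl : t.length = k := by simpa using h
    rfl

lemma realize_push (σ : C(Simp n, X)) (w : Fin (m + 1) → Simp n) (c : AffineChains m) :
    realize σ (AffineChains.push w c) = realize (σ.comp (affine w)) c := by
  suffices realize σ ∘ₗ AffineChains.push w = realize (σ.comp (affine w)) from
    LinearMap.congr_fun this c
  refine Finsupp.lhom_ext' fun s => LinearMap.ext_ring ?_
  obtain _ | ⟨a, t⟩ := s
  · simp [listRealize]
  · simp only [LinearMap.comp_apply, Finsupp.lsingle_apply, AffineChains.push_single,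
      realize_single]
    rw [listRealize_eq _ _ t.length (by simp), listRealize_eq _ (a :: t) t.length (by simp),
      ContinuousMap.comp_assoc, affine_comp_affine]
    simp only [List.get_eq_getElem, List.getElem_map, Fin.val_cast]

lemma bd_realize (σ : C(Simp n, X)) (c : AffineChains n) :
    bd (realize σ c) = realize σ (AffineChains.bd c) := by
  suffices bd ∘ₗ realize σ = realize σ ∘ₗ AffineChains.bd from LinearMap.congr_fun this c
  refine Finsupp.lhom_ext' fun s => LinearMap.ext_ring ?_
  simp only [LinearMap.comp_apply, Finsupp.lsingle_apply, AffineChains.bd_single, realize_single]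
  obtain _ | ⟨a, _ | ⟨b, t⟩⟩ := s
  · simp [listRealize, AffineChains.listBoundary]
  · simp [listRealize, AffineChains.listBoundary, simplexBoundary]
  · rw [listRealize_eq _ _ (t.length + 1) (by simp), bd_single, AffineChains.listBoundary_eq_sum]
    simp only [simplexBoundary, map_sum, map_smul, realize_single]
    refine Fintype.sum_equiv (finCongr (by simp)) _ _ fun i => ?_
    have hi := i.2
    rw [listRealize_eq _ _ t.length (by grind [List.length_eraseIdx]), ContinuousMap.comp_assoc,
      affine_comp_face]
    congr! 5
    ext1 j
    simp only [List.get_eq_getElem, List.getElem_eraseIdx, Fin.val_cast, finCongr_apply,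
      Fin.succAbove, Fin.lt_def, Fin.val_castSucc]
    split_ifs <;> simp

variable (n) in
/-- The list of the vertices of the standard simplex. -/
noncomputable def std : List (Simp n) := List.ofFn fun i => stdSimplex.vertex i

lemma listRealize_std (σ : C(Simp n, X)) : listRealize σ (std n) = Finsupp.single ⟨n, σ⟩ 1 := by
  rw [listRealize_eq _ _ n (by simp [std])]
  have : (fun i : Fin (n + 1) => (std n).get (i.cast (by simp [std]))) =
      fun i => stdSimplex.vertex (S := ℝ) i := by
    ext1 i
    simp only [std, List.get_eq_getElem, List.getElem_ofFn]
    rfl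
  rw [this, affine_vertices, ContinuousMap.comp_id]

lemma map_std (l : List (Simp n)) (k : ℕ) (h : l.length = k + 1) :
    (std k).map (affine fun i : Fin (k + 1) => l.get (i.cast h.symm)) = l := by
  rw [std, List.map_ofFn]
  refine List.ext_getElem (by simp [h]) fun i h1 h2 => ?_
  simp [affine_vertex, -List.ofFn_succ]

lemma bd_bd (c : Chains X) : bd (bd c) = 0 := by
  suffices bd ∘ₗ bd = (0 : Chains X →ₗ[ℚ] Chains X) from LinearMap.congr_fun this c
  refine Finsupp.lhom_ext' fun s => LinearMap.ext_ring ?_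
  simp only [LinearMap.comp_apply, Finsupp.lsingle_apply]
  rw [← listRealize_std, ← realize_single, bd_realize, bd_realize, AffineChains.bd_bd, map_zero]
  rfl

/-- The operator on singular chains induced by a natural operator on affine chains. -/
noncomputable def extendOp (F : ∀ n, AffineChains n →ₗ[ℚ] AffineChains n) :
    Chains X →ₗ[ℚ] Chains X :=
  Finsupp.linearCombination ℚ fun s => realize s.2 (F s.1 (Finsupp.single (std s.1) 1))

@[simp] lemma extendOp_single (F : ∀ n, AffineChains n →ₗ[ℚ] AffineChains n)
    (s : SingularSimplex X) : extendOp F (Finsupp.single s 1) =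
      realize s.2 (F s.1 (Finsupp.single (std s.1) 1)) := by
  simp [extendOp]

lemma extendOp_realize {F : ∀ n, AffineChains n →ₗ[ℚ] AffineChains n}
    (hF : ∀ (k n : ℕ) (w : Fin (k + 1) → Simp n) (c : AffineChains k),
      AffineChains.push w (F k c) = F n (AffineChains.push w c))
    (σ : C(Simp n, X)) (h0 : realize σ (F n (Finsupp.single [] 1)) = 0) (c : AffineChains n) :
    extendOp F (realize σ c) = realize σ (F n c) := by
  suffices extendOp F ∘ₗ realize σ = realize σ ∘ₗ F n from LinearMap.congr_fun this c
  refine Finsupp.lhom_ext' fun s => LinearMap.ext_ring ?_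
  simp only [LinearMap.comp_apply, Finsupp.lsingle_apply, realize_single]
  obtain _ | ⟨a, t⟩ := s
  · simp [listRealize, h0]
  · rw [listRealize_eq _ _ t.length (by simp), extendOp_single, ← realize_push, hF,
      AffineChains.push_single, map_std _ _ (by simp)]

/-- Barycentric subdivision of singular chains. -/
noncomputable def sd : Chains X →ₗ[ℚ] Chains X := extendOp fun _ => AffineChains.sd

/-- The chain homotopy between the identity and barycentric subdivision. -/
noncomputable def htpy : Chains X →ₗ[ℚ] Chains X := extendOp fun _ => AffineChains.htpy

lemma sd_realize (σ : C(Simp n, X)) (c : AffineChains n) :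
    sd (realize σ c) = realize σ (AffineChains.sd c) :=
  extendOp_realize (fun _ _ => AffineChains.push_sd) σ
    (by simp [AffineChains.listSd, listRealize]) c

lemma htpy_realize (σ : C(Simp n, X)) (c : AffineChains n) :
    htpy (realize σ c) = realize σ (AffineChains.htpy c) :=
  extendOp_realize (fun _ _ => AffineChains.push_htpy) σ
    (by simp [AffineChains.listHtpy]) c

lemma bd_sd (c : Chains X) : bd (sd c) = sd (bd c) := by
  suffices bd ∘ₗ sd = (sd ∘ₗ bd : Chains X →ₗ[ℚ] Chains X) from LinearMap.congr_fun this c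
  refine Finsupp.lhom_ext' fun s => LinearMap.ext_ring ?_
  simp only [LinearMap.comp_apply, Finsupp.lsingle_apply]
  rw [← listRealize_std, ← realize_single, bd_realize, sd_realize, sd_realize, bd_realize,
    AffineChains.bd_sd]

lemma bd_htpy (c : Chains X) : bd (htpy c) + htpy (bd c) = c - sd c := by
  suffices bd ∘ₗ htpy + htpy ∘ₗ bd = (LinearMap.id - sd : Chains X →ₗ[ℚ] Chains X) from
    LinearMap.congr_fun this c
  refine Finsupp.lhom_ext' fun s => LinearMap.ext_ring ?_
  simp only [LinearMap.comp_apply, LinearMap.add_apply, LinearMap.sub_apply, LinearMap.id_apply,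
    Finsupp.lsingle_apply]
  rw [← listRealize_std, ← realize_single, bd_realize, htpy_realize, htpy_realize, bd_realize,
    sd_realize, ← map_add, AffineChains.bd_htpy, map_sub]

end Realization

section Support

variable {X Y : Type*} [TopologicalSpace X] [TopologicalSpace Y]

/-- The singular chains of `X` supported in the subset `A`. -/
noncomputable def chainsIn (A : Set X) : Submodule ℚ (Chains X) :=
  Finsupp.supported ℚ ℚ {s | Set.range s.2 ⊆ A}

lemma single_mem_chainsIn {A : Set X} {s : SingularSimplex X} (h : Set.range s.2 ⊆ A) (q : ℚ) :
    Finsupp.single s q ∈ chainsIn A := Finsupp.single_mem_supported _ _ h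

lemma map_mem_of_mem_supported {α M : Type*} [AddCommGroup M] [Module ℚ M] {S : Set α}
    {f : (α →₀ ℚ) →ₗ[ℚ] M} {P : Submodule ℚ M} (h : ∀ s ∈ S, f (Finsupp.single s 1) ∈ P)
    {c : α →₀ ℚ} (hc : c ∈ Finsupp.supported ℚ ℚ S) : f c ∈ P := by
  have : Finsupp.supported ℚ ℚ S ≤ P.comap f := by
    rw [Finsupp.supported_eq_span_single, Submodule.span_le]
    rintro _ ⟨s, hs, rfl⟩
    exact h s hs
  exact this hc

lemma map_mem_of_mem_chainsIn {M : Type*} [AddCommGroup M] [Module ℚ M] {A : Set X}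
    {f : Chains X →ₗ[ℚ] M} {P : Submodule ℚ M}
    (h : ∀ s : SingularSimplex X, Set.range s.2 ⊆ A → f (Finsupp.single s 1) ∈ P)
    {c : Chains X} (hc : c ∈ chainsIn A) : f c ∈ P := map_mem_of_mem_supported h hc

lemma chainsIn_mono {A B : Set X} (h : A ⊆ B) : chainsIn A ≤ chainsIn B :=
  Finsupp.supported_mono fun _ hs => hs.trans h

lemma mem_chainsIn_inter {A B : Set X} {c : Chains X} (hA : c ∈ chainsIn A) (hB : c ∈ chainsIn B) :
    c ∈ chainsIn (A ∩ B) := fun _ hs => Set.subset_inter (hA hs) (hB hs)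

lemma mem_chainsIn_univ (c : Chains X) : c ∈ chainsIn (Set.univ : Set X) :=
  fun _ _ => Set.subset_univ (Set.range _)

lemma chainsIn_empty : chainsIn (∅ : Set X) = ⊥ := by
  have : {s : SingularSimplex X | Set.range s.2 ⊆ ∅} = ∅ := by
    ext s
    simp [Set.range_eq_empty_iff]
  rw [chainsIn, this, Finsupp.supported_empty]

lemma realize_mem_chainsIn {n : ℕ} (σ : C(Simp n, X)) (c : AffineChains n) :
    realize σ c ∈ chainsIn (Set.range σ) := by
  induction c using Finsupp.induction_linear with
  | zero => simp
  | add a b ha hb => rw [map_add]; exact add_mem ha hb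
  | single l q =>
    rw [← mul_one q, ← smul_eq_mul, ← Finsupp.smul_single, map_smul, realize_single]
    refine Submodule.smul_mem _ _ ?_
    obtain _ | ⟨a, t⟩ := l
    · exact zero_mem _
    · refine single_mem_chainsIn (s := ⟨t.length, _⟩) ?_ 1
      rintro _ ⟨x, rfl⟩
      exact ⟨_, rfl⟩

lemma bd_mem_chainsIn {A : Set X} {c : Chains X} (hc : c ∈ chainsIn A) : bd c ∈ chainsIn A :=
  map_mem_of_mem_chainsIn (fun s hs => by
    rw [← listRealize_std s.2, ← realize_single, bd_realize]
    exact chainsIn_mono hs (realize_mem_chainsIn _ _)) hc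

lemma sd_mem_chainsIn {A : Set X} {c : Chains X} (hc : c ∈ chainsIn A) : sd c ∈ chainsIn A :=
  map_mem_of_mem_chainsIn (fun s hs => by
    rw [sd, extendOp_single]
    exact chainsIn_mono hs (realize_mem_chainsIn _ _)) hc

lemma htpy_mem_chainsIn {A : Set X} {c : Chains X} (hc : c ∈ chainsIn A) : htpy c ∈ chainsIn A :=
  map_mem_of_mem_chainsIn (fun s hs => by
    rw [htpy, extendOp_single]
    exact chainsIn_mono hs (realize_mem_chainsIn _ _)) hc

lemma push_mem_chainsIn (f : C(X, Y)) {A : Set X} {B : Set Y} (h : Set.MapsTo f A B)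
    {c : Chains X} (hc : c ∈ chainsIn A) : push f c ∈ chainsIn B :=
  map_mem_of_mem_chainsIn (fun _ hs => by
    rw [push_single]
    refine single_mem_chainsIn ?_ _
    rintro _ ⟨t, rfl⟩
    exact h (hs ⟨t, rfl⟩)) hc

end Support

namespace AffineChains

variable {n : ℕ}

/-- The convex hull of the vertices of an affine simplex. -/
def hull (l : List (Simp n)) : Set (Fin (n + 1) → ℝ) := convexHull ℝ ((↑) '' {x | x ∈ l})

lemma hull_mono {l l' : List (Simp n)} (h : l ⊆ l') : hull l ⊆ hull l' :=
  convexHull_mono (Set.image_mono fun _ hx => h hx)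

lemma affine_mem_hull (l : List (Simp n)) {k : ℕ} (v : Fin (k + 1) → Simp n)
    (hv : ∀ i, v i ∈ l) (t : Simp k) : (affine v t : Fin (n + 1) → ℝ) ∈ hull l := by
  rw [affine_coe]
  exact (convex_convexHull ℝ _).sum_mem (fun i _ => t.2.1 i) t.2.2
    fun i _ => subset_convexHull ℝ _ ⟨v i, hv i, rfl⟩

lemma bary_mem_hull (a : Simp n) (t : List (Simp n)) :
    (bary (a :: t) : Fin (n + 1) → ℝ) ∈ hull (a :: t) :=
  affine_mem_hull _ _ (fun _ => List.get_mem _ _) _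

/-- All vertices of the affine simplex are at pairwise distance at most `D`. -/
def DiamLE (D : ℝ) (l : List (Simp n)) : Prop := ∀ a ∈ l, ∀ b ∈ l, dist a b ≤ D

lemma dist_bary_le {D : ℝ} (a : Simp n) (t : List (Simp n)) (h : DiamLE D (a :: t)) (x : Simp n)
    (hx : (x : Fin (n + 1) → ℝ) ∈ hull (a :: t)) :
    dist (bary (a :: t)) x ≤ t.length / (t.length + 1) * D := by
  suffices hull (a :: t) ⊆ Metric.closedBall (bary (a :: t) : Fin (n + 1) → ℝ)
      (t.length / (t.length + 1) * D) by
    rw [dist_comm]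
    exact this hx
  refine convexHull_min ?_ (convex_closedBall _ _)
  rintro _ ⟨v, hv, rfl⟩
  obtain ⟨j, rfl⟩ := List.mem_iff_get.1 hv
  have hk : (0 : ℝ) < t.length + 1 := by positivity
  change dist _ _ ≤ _
  rw [dist_comm, dist_eq_norm, bary, affine_coe]
  have : ∀ w : Fin (n + 1) → ℝ, ∀ f : Fin (t.length + 1) → Fin (n + 1) → ℝ,
      (∑ i, (stdSimplex.barycenter (𝕜 := ℝ) (X := Fin (t.length + 1))) i • f i) - w =
      ∑ i, ((t.length : ℝ) + 1)⁻¹ • (f i - w) := by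
    intro w f
    have hb : ∀ i, (stdSimplex.barycenter (𝕜 := ℝ) (X := Fin (t.length + 1))) i =
        ((t.length : ℝ) + 1)⁻¹ := fun i => by
      refine (stdSimplex.barycenter_apply i).trans ?_
      simp
    simp only [hb, smul_sub, Finset.sum_sub_distrib, Finset.sum_const, Finset.card_univ,
      Fintype.card_fin]
    rw [← Nat.cast_smul_eq_nsmul ℝ, smul_smul]
    push_cast
    rw [mul_inv_cancel₀ hk.ne', one_smul]
  rw [this]
  refine (norm_sum_le _ _).trans ?_
  rw [← Finset.add_sum_erase Finset.univ (fun i : Fin (t.length + 1) =>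
    ‖((t.length : ℝ) + 1)⁻¹ • (⇑((a :: t).get i) - ⇑((a :: t).get j))‖)
    (Finset.mem_univ (α := Fin (t.length + 1)) j)]
  simp only [sub_self, smul_zero, norm_zero, zero_add]
  refine (Finset.sum_le_card_nsmul _ _ (((t.length : ℝ) + 1)⁻¹ * D) fun i _ => ?_).trans ?_
  · rw [norm_smul, Real.norm_of_nonneg (by positivity), ← dist_eq_norm]
    exact mul_le_mul_of_nonneg_left (h _ (List.get_mem _ _) _ (List.get_mem _ _)) (by positivity)
  · rw [Finset.card_erase_of_mem (Finset.mem_univ j)]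
    simp only [Finset.card_univ, List.length_cons, Fintype.card_fin, nsmul_eq_mul]
    rw [div_eq_mul_inv, mul_assoc]
    simp

lemma listSd_mem (N : ℕ) (D : ℝ) (l : List (Simp n)) (hl : l.length ≤ N + 1) (hD : DiamLE D l) :
    listSd l ∈ Finsupp.supported ℚ ℚ {l' | DiamLE (N / (N + 1) * D) l' ∧
      l'.length = l.length ∧ ∀ x ∈ l', (x : Fin (n + 1) → ℝ) ∈ hull l} := by
  induction l using listBoundary_induction with
  | nil =>
    rw [listSd]
    exact Finsupp.single_mem_supported _ _ (by simp [DiamLE])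
  | cons a t ih =>
    have hD0 : 0 ≤ D := by simpa using hD a (by simp) a (by simp)
    have hN : (t.length : ℝ) / (t.length + 1) ≤ N / (N + 1) := by
      have : (t.length : ℝ) ≤ N := by
        simp only [List.length_cons] at hl
        exact_mod_cast (by omega : t.length ≤ N)
      rw [div_le_div_iff₀ (by positivity) (by positivity)]
      nlinarith
    have hmem : sd (listBoundary (a :: t)) ∈ Finsupp.supported ℚ ℚ
        {l' | DiamLE (N / (N + 1) * D) l' ∧ l'.length = t.length ∧
          ∀ x ∈ l', (x : Fin (n + 1) → ℝ) ∈ hull (a :: t)} := by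
      rw [listBoundary_eq_sum, map_sum]
      refine sum_mem fun i _ => ?_
      rw [map_smul, sd_single]
      have hi := i.2
      have hsub : (a :: t).eraseIdx i ⊆ a :: t := List.eraseIdx_subset
      refine Submodule.smul_mem _ _ (Finsupp.supported_mono ?_
        (ih i (by grind [List.length_eraseIdx])
          fun x hx y hy => hD x (hsub hx) y (hsub hy)))
      rintro l' ⟨h1, h2, h3⟩
      exact ⟨h1, by grind [List.length_eraseIdx], fun x hx => hull_mono hsub (h3 x hx)⟩
    rw [listSd_cons]
    refine map_mem_of_mem_supported ?_ hmem
    rintro l' ⟨h1, h2, h3⟩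
    rw [cone_single]
    have hb : ∀ x ∈ l', dist (bary (a :: t)) x ≤ N / (N + 1) * D := fun x hx =>
      (dist_bary_le a t hD x (h3 x hx)).trans (mul_le_mul_of_nonneg_right hN hD0)
    refine Finsupp.single_mem_supported _ _ ⟨?_, by simp [h2], ?_⟩
    · intro x hx y hy
      rcases List.mem_cons.1 hx with rfl | hx <;> rcases List.mem_cons.1 hy with rfl | hy
      · rw [dist_self]
        positivity
      · exact hb y hy
      · rw [dist_comm]
        exact hb x hx
      · exact h1 x hx y hy
    · intro x hx
      rcases List.mem_cons.1 hx with rfl | hx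
      · exact bary_mem_hull a t
      · exact h3 x hx

lemma sd_pow_mem (N p : ℕ) (D : ℝ) (l : List (Simp n)) (hl : l.length = N + 1) (hD : DiamLE D l) :
    (sd ^ p) (Finsupp.single l 1) ∈ Finsupp.supported ℚ ℚ
      {l' | DiamLE ((N / (N + 1) : ℝ) ^ p * D) l' ∧ l'.length = N + 1} := by
  induction p with
  | zero => exact Finsupp.single_mem_supported _ _ ⟨by simpa using hD, hl⟩
  | succ p ih =>
    rw [pow_succ' sd, Module.End.mul_apply]
    refine map_mem_of_mem_supported ?_ ih
    rintro l' ⟨h1, h2⟩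
    rw [sd_single]
    refine Finsupp.supported_mono ?_ (listSd_mem N _ l' h2.le h1)
    rintro l'' ⟨h3, h4, -⟩
    exact ⟨by rwa [pow_succ', mul_assoc], h4.trans h2⟩

end AffineChains

variable {X : Type*} [TopologicalSpace X]

lemma sd_pow_realize {n : ℕ} (σ : C(Simp n, X)) (p : ℕ) (c : AffineChains n) :
    (sd ^ p) (realize σ c) = realize σ ((AffineChains.sd ^ p) c) := by
  induction p with
  | zero => rfl
  | succ p ih =>
    rw [pow_succ', pow_succ', Module.End.mul_apply, Module.End.mul_apply, ih, sd_realize]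

lemma exists_sd_pow_single_mem {U V : Set X} (hU : IsOpen U) (hV : IsOpen V)
    (s : SingularSimplex X) (hs : Set.range s.2 ⊆ U ∪ V) :
    ∃ p : ℕ, (sd ^ p) (Finsupp.single s 1) ∈ chainsIn U ⊔ chainsIn V := by
  obtain ⟨n, σ⟩ := s
  obtain ⟨δ, hδ, hball⟩ := lebesgue_number_lemma_of_metric (s := (Set.univ : Set (Simp n)))
    (c := fun b : Bool => σ ⁻¹' (bif b then U else V)) isCompact_univ
    (by rintro (_ | _)
        · exact hV.preimage σ.continuous
        · exact hU.preimage σ.continuous)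
    (by
      intro x _
      rcases hs ⟨x, rfl⟩ with h | h
      · exact Set.mem_iUnion.2 ⟨true, h⟩
      · exact Set.mem_iUnion.2 ⟨false, h⟩)
  obtain ⟨p, hp⟩ : ∃ p : ℕ, ((n / (n + 1) : ℝ)) ^ p * Metric.diam (Set.univ : Set (Simp n)) < δ := by
    have h1 : (n / (n + 1) : ℝ) < 1 := by
      rw [div_lt_one (by positivity)]
      linarith
    have := (tendsto_pow_atTop_nhds_zero_of_lt_one (by positivity) h1).mul_const
      (Metric.diam (Set.univ : Set (Simp n)))
    rw [zero_mul] at this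
    exact (this.eventually (gt_mem_nhds hδ)).exists
  refine ⟨p, ?_⟩
  rw [← listRealize_std, ← realize_single, sd_pow_realize]
  refine map_mem_of_mem_supported ?_ (AffineChains.sd_pow_mem n p
    (Metric.diam (Set.univ : Set (Simp n))) (std n) (by simp [std]) fun a _ b _ =>
      Metric.dist_le_diam_of_mem (isCompact_univ.isBounded) trivial trivial)
  rintro l ⟨h1, h2⟩
  rw [realize_single, listRealize_eq _ _ n h2]
  obtain ⟨b, hb⟩ := hball (l.get ((0 : Fin (n + 1)).cast h2.symm)) trivial
  have hsub : Set.range (σ.comp (affine fun i : Fin (n + 1) => l.get (i.cast h2.symm))) ⊆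
      bif b then U else V := by
    rintro _ ⟨t, rfl⟩
    refine hb ?_
    refine lt_of_le_of_lt ?_ hp
    have : AffineChains.hull l ⊆ Metric.closedBall
        (l.get ((0 : Fin (n + 1)).cast h2.symm) : Fin (n + 1) → ℝ)
        (((n / (n + 1) : ℝ)) ^ p * Metric.diam (Set.univ : Set (Simp n))) := by
      refine convexHull_min ?_ (convex_closedBall _ _)
      rintro _ ⟨v, hv, rfl⟩
      exact h1 _ hv _ (List.get_mem _ _)
    exact this (AffineChains.affine_mem_hull l _ (fun _ => List.get_mem _ _) t)
  cases b
  · exact Submodule.mem_sup_right (single_mem_chainsIn (s := ⟨n, _⟩) hsub 1)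
  · exact Submodule.mem_sup_left (single_mem_chainsIn (s := ⟨n, _⟩) hsub 1)

lemma sd_mem_sup {U V : Set X} {c : Chains X} (hc : c ∈ chainsIn U ⊔ chainsIn V) :
    sd c ∈ chainsIn U ⊔ chainsIn V := by
  obtain ⟨u, hu, v, hv, rfl⟩ := Submodule.mem_sup.1 hc
  rw [map_add]
  exact Submodule.add_mem_sup (sd_mem_chainsIn hu) (sd_mem_chainsIn hv)

lemma htpy_mem_sup {U V : Set X} {c : Chains X} (hc : c ∈ chainsIn U ⊔ chainsIn V) :
    htpy c ∈ chainsIn U ⊔ chainsIn V := by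
  obtain ⟨u, hu, v, hv, rfl⟩ := Submodule.mem_sup.1 hc
  rw [map_add]
  exact Submodule.add_mem_sup (htpy_mem_chainsIn hu) (htpy_mem_chainsIn hv)

lemma sd_pow_mem_sup {U V : Set X} {c : Chains X} {p q : ℕ} (hpq : p ≤ q)
    (hc : (sd ^ p) c ∈ chainsIn U ⊔ chainsIn V) : (sd ^ q) c ∈ chainsIn U ⊔ chainsIn V := by
  induction q, hpq using Nat.le_induction with
  | base => exact hc
  | succ q _ ih =>
    rw [pow_succ', Module.End.mul_apply]
    exact sd_mem_sup ih

lemma exists_sd_pow_mem {U V : Set X} (hU : IsOpen U) (hV : IsOpen V) {c : Chains X}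
    (hc : c ∈ chainsIn (U ∪ V)) : ∃ p : ℕ, (sd ^ p) c ∈ chainsIn U ⊔ chainsIn V := by
  rw [chainsIn, Finsupp.supported_eq_span_single] at hc
  induction hc using Submodule.span_induction with
  | mem x h =>
    obtain ⟨s, hs, rfl⟩ := h
    exact exists_sd_pow_single_mem hU hV s hs
  | zero => exact ⟨0, by simp⟩
  | add x y _ _ hx hy =>
    obtain ⟨p, hp⟩ := hx
    obtain ⟨q, hq⟩ := hy
    refine ⟨max p q, ?_⟩
    rw [map_add]
    exact add_mem (sd_pow_mem_sup (le_max_left _ _) hp) (sd_pow_mem_sup (le_max_right _ _) hq)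
  | smul a x _ hx =>
    obtain ⟨p, hp⟩ := hx
    exact ⟨p, by rw [map_smul]; exact Submodule.smul_mem _ _ hp⟩

lemma exists_sub_sd_pow_sub_bd_mem {U V : Set X} (p : ℕ) {c : Chains X}
    (hc : c ∈ chainsIn (U ∪ V)) (hbd : bd c ∈ chainsIn U ⊔ chainsIn V) :
    ∃ g ∈ chainsIn (U ∪ V), c - (sd ^ p) c - bd g ∈ chainsIn U ⊔ chainsIn V := by
  induction p generalizing c with
  | zero => exact ⟨0, zero_mem _, by simp⟩
  | succ p ih =>
    obtain ⟨g, hg, h⟩ := ih (sd_mem_chainsIn hc) (by rw [bd_sd]; exact sd_mem_sup hbd)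
    refine ⟨g + htpy c, add_mem hg (htpy_mem_chainsIn hc), ?_⟩
    have e : c - (sd ^ (p + 1)) c - bd (g + htpy c) =
        (sd c - (sd ^ p) (sd c) - bd g) + htpy (bd c) := by
      rw [pow_succ, Module.End.mul_apply, map_add, eq_sub_of_add_eq (bd_htpy c)]
      abel
    rw [e]
    exact add_mem h (htpy_mem_sup hbd)

/-- The theorem of small chains: a chain in `U ∪ V` whose boundary is a sum of chains in `U` and in
`V` is homologous to such a sum. -/
theorem exists_eq_bd_add_add {U V : Set X} (hU : IsOpen U) (hV : IsOpen V) {c : Chains X}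
    (hc : c ∈ chainsIn (U ∪ V)) (hbd : bd c ∈ chainsIn U ⊔ chainsIn V) :
    ∃ g ∈ chainsIn (U ∪ V), ∃ u ∈ chainsIn U, ∃ v ∈ chainsIn V, c = bd g + u + v := by
  obtain ⟨p, hp⟩ := exists_sd_pow_mem hU hV hc
  obtain ⟨g, hg, h⟩ := exists_sub_sd_pow_sub_bd_mem p hc hbd
  have : c - bd g ∈ chainsIn U ⊔ chainsIn V := by
    have := add_mem h hp
    rwa [show c - (sd ^ p) c - bd g + (sd ^ p) c = c - bd g by abel] at this
  obtain ⟨u, hu, v, hv, e⟩ := Submodule.mem_sup.1 this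
  exact ⟨g, hg, u, hu, v, hv, by rw [add_assoc, e]; abel⟩

lemma face_succAbove {k : ℕ} (i : Fin (k + 2)) (t : Simp k) (l : Fin (k + 1)) :
    face i t (i.succAbove l) = t l := by
  simp [face, affine_apply, Pi.single_apply]

lemma face_self {k : ℕ} (i : Fin (k + 2)) (t : Simp k) : face i t i = 0 := by
  simp only [face, affine_apply, stdSimplex.vertex_coe, Pi.single_apply]
  exact Finset.sum_eq_zero fun l _ => by simp [(Fin.succAbove_ne i l).symm]

/-- The quotient map exhibiting a simplex as the cone over its `0`-th face. -/
noncomputable def joinMap (k : ℕ) : C(unitInterval × Simp k, Simp (k + 1)) where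
  toFun p := ⟨Fin.cons (p.1 : ℝ) fun i => (1 - (p.1 : ℝ)) * p.2 i, by
    refine ⟨fun i => ?_, ?_⟩
    · refine Fin.cases ?_ (fun i => ?_) i
      · exact p.1.2.1
      · exact mul_nonneg (sub_nonneg.2 p.1.2.2) (p.2.2.1 i)
    · rw [Fin.sum_univ_succ]
      simp [← Finset.mul_sum]⟩
  continuous_toFun := by
    refine Continuous.subtype_mk (continuous_pi fun i => ?_) _
    refine Fin.cases ?_ (fun i => ?_) i
    · exact continuous_subtype_val.comp continuous_fst
    · exact (continuous_const.sub (continuous_subtype_val.comp continuous_fst)).mul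
        ((continuous_apply i).comp (continuous_subtype_val.comp continuous_snd))

@[simp] lemma joinMap_zero {k : ℕ} (p : unitInterval × Simp k) : joinMap k p 0 = p.1 := rfl

@[simp] lemma joinMap_succ {k : ℕ} (p : unitInterval × Simp k) (i : Fin (k + 1)) :
    joinMap k p i.succ = (1 - (p.1 : ℝ)) * p.2 i := rfl

lemma joinMap_surjective (k : ℕ) : Function.Surjective (joinMap k) := by
  intro t
  have hsum : t 0 + ∑ i : Fin (k + 1), t i.succ = 1 := by
    rw [← Fin.sum_univ_succ]
    exact t.2.2
  have h0 : 0 ≤ t 0 := t.2.1 0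
  have hs : 0 ≤ ∑ i : Fin (k + 1), t i.succ := Finset.sum_nonneg fun i _ => t.2.1 _
  by_cases h : t 0 = 1
  · refine ⟨(1, stdSimplex.vertex 0), ?_⟩
    ext j
    refine Fin.cases ?_ (fun i => ?_) j
    · simp [h]
    · have : ∑ i : Fin (k + 1), t i.succ = 0 := by linarith
      rw [Finset.sum_eq_zero_iff_of_nonneg (f := fun i : Fin (k + 1) => t i.succ)
        fun i _ => t.2.1 _] at this
      simpa using (this i (Finset.mem_univ i)).symm
  · have h1 : 0 < 1 - t 0 := lt_of_le_of_ne (by linarith) fun e => h (by linarith)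
    refine ⟨(⟨t 0, h0, by linarith⟩, ⟨fun i => t i.succ / (1 - t 0),
      fun i => div_nonneg (t.2.1 _) h1.le, ?_⟩), ?_⟩
    · rw [← Finset.sum_div, div_eq_one_iff_eq h1.ne']
      linarith
    · ext j
      refine Fin.cases ?_ (fun i => ?_) j
      · simp
      · exact mul_div_cancel₀ _ h1.ne'

lemma isQuotientMap_joinMap (k : ℕ) : Topology.IsQuotientMap (joinMap k) :=
  Topology.IsQuotientMap.of_surjective_continuous (joinMap_surjective k) (joinMap k).continuous

lemma joinMap_eq_face_zero {k : ℕ} (t : Simp k) : face 0 t = joinMap k (0, t) := by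
  ext j
  refine Fin.cases ?_ (fun i => ?_) j
  · rw [face_self]
    simp
  · have := face_succAbove 0 t i
    rw [Fin.succAbove_zero] at this
    simp [this]

lemma face_succ_joinMap {k : ℕ} (i : Fin (k + 2)) (p : unitInterval × Simp k) :
    face i.succ (joinMap k p) = joinMap (k + 1) (p.1, face i p.2) := by
  ext j
  refine Fin.cases ?_ (fun j => ?_) j
  · have := face_succAbove i.succ (joinMap k p) 0
    rw [Fin.succ_succAbove_zero] at this
    simp [this]
  · obtain rfl | ⟨l, rfl⟩ := Fin.eq_self_or_eq_succAbove i j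
    · rw [face_self, joinMap_succ, face_self, mul_zero]
    · have := face_succAbove i.succ (joinMap k p) l.succ
      rw [Fin.succ_succAbove_succ] at this
      rw [this, joinMap_succ, joinMap_succ, face_succAbove]

lemma face_one_eq_joinMap (t : Simp 0) : face 1 t = joinMap 0 (1, t) := by
  ext j
  refine Fin.cases ?_ (fun j => ?_) j
  · have := face_succAbove 1 t 0
    rw [show (1 : Fin 2).succAbove 0 = 0 from rfl] at this
    rw [this, joinMap_zero]
    simp
  · obtain rfl : j = 0 := Subsingleton.elim _ _
    rw [show Fin.succ (0 : Fin 1) = (1 : Fin 2) from rfl, face_self]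
    have := joinMap_succ ((1 : unitInterval), t) 0
    rw [show Fin.succ (0 : Fin 1) = (1 : Fin 2) from rfl] at this
    simp [this]

section Cone

variable {E : Type*} [AddCommGroup E] [Module ℝ E] [TopologicalSpace E] [ContinuousAdd E]
  [ContinuousSMul ℝ E]

/-- The straight-line homotopy from a singular simplex to the constant map at `b`. -/
noncomputable def coneHomotopy (b : E) {k : ℕ} (σ : C(Simp k, E)) : C(unitInterval × Simp k, E) :=
  ⟨fun p => (p.1 : ℝ) • b + (1 - (p.1 : ℝ)) • σ p.2, by fun_prop⟩

lemma coneHomotopy_apply (b : E) {k : ℕ} (σ : C(Simp k, E)) (p : unitInterval × Simp k) :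
    coneHomotopy b σ p = (p.1 : ℝ) • b + (1 - (p.1 : ℝ)) • σ p.2 := rfl

lemma coneHomotopy_factorsThrough (b : E) {k : ℕ} (σ : C(Simp k, E)) :
    Function.FactorsThrough (coneHomotopy b σ) (joinMap k) := by
  intro p q h
  have h0 : (p.1 : ℝ) = q.1 := by
    rw [← joinMap_zero p, h, joinMap_zero]
  rw [coneHomotopy_apply, coneHomotopy_apply, h0]
  by_cases h1 : (q.1 : ℝ) = 1
  · simp [h1]
  · have : p.2 = q.2 := by
      ext i
      have := joinMap_succ p i
      rw [h, joinMap_succ, h0] at this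
      exact (mul_left_cancel₀ (sub_ne_zero.2 (Ne.symm h1)) this).symm
    rw [this]

/-- The cone with apex `b` over a singular simplex. -/
noncomputable def coneSimplex (b : E) {k : ℕ} (σ : C(Simp k, E)) : C(Simp (k + 1), E) :=
  (isQuotientMap_joinMap k).lift (coneHomotopy b σ) (coneHomotopy_factorsThrough b σ)

lemma coneSimplex_joinMap (b : E) {k : ℕ} (σ : C(Simp k, E)) (p : unitInterval × Simp k) :
    coneSimplex b σ (joinMap k p) = (p.1 : ℝ) • b + (1 - (p.1 : ℝ)) • σ p.2 :=
  DFunLike.congr_fun ((isQuotientMap_joinMap k).lift_comp (coneHomotopy b σ)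
    (coneHomotopy_factorsThrough b σ)) p

lemma coneSimplex_face_zero (b : E) {k : ℕ} (σ : C(Simp k, E)) :
    (coneSimplex b σ).comp (face 0) = σ := by
  ext t
  rw [ContinuousMap.comp_apply, joinMap_eq_face_zero, coneSimplex_joinMap]
  simp

lemma coneSimplex_face_succ (b : E) {k : ℕ} (σ : C(Simp (k + 1), E)) (i : Fin (k + 2)) :
    (coneSimplex b σ).comp (face i.succ) = coneSimplex b (σ.comp (face i)) := by
  ext t
  obtain ⟨p, rfl⟩ := joinMap_surjective k t
  rw [ContinuousMap.comp_apply, face_succ_joinMap, coneSimplex_joinMap, coneSimplex_joinMap]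
  rfl

lemma coneSimplex_face_one (b : E) (σ : C(Simp 0, E)) :
    (coneSimplex b σ).comp (face 1) = ContinuousMap.const _ b := by
  ext t
  rw [ContinuousMap.comp_apply, face_one_eq_joinMap, coneSimplex_joinMap]
  simp

/-- The cone operator on singular chains. -/
noncomputable def coneOp (b : E) : Chains E →ₗ[ℚ] Chains E :=
  Finsupp.linearCombination ℚ fun s => Finsupp.single ⟨s.1 + 1, coneSimplex b s.2⟩ 1

@[simp] lemma coneOp_single (b : E) (s : SingularSimplex E) :
    coneOp b (Finsupp.single s 1) = Finsupp.single ⟨s.1 + 1, coneSimplex b s.2⟩ 1 := by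
  simp [coneOp]

lemma coneOp_mem_chainsIn {b : E} {Y : Set E} (hY : StarConvex ℝ b Y) {c : Chains E}
    (hc : c ∈ chainsIn Y) : coneOp b c ∈ chainsIn Y := by
  refine map_mem_of_mem_chainsIn (fun s hs => ?_) hc
  rw [coneOp_single]
  refine single_mem_chainsIn ?_ _
  rintro _ ⟨t, rfl⟩
  obtain ⟨p, rfl⟩ := joinMap_surjective _ t
  change coneSimplex b s.2 _ ∈ Y
  rw [coneSimplex_joinMap]
  exact hY (hs ⟨p.2, rfl⟩) p.1.2.1 (sub_nonneg.2 p.1.2.2) (by ring)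

end Cone

section Augmentation

variable {X : Type*} [TopologicalSpace X]

/-- The augmentation of the singular chains. -/
noncomputable def aug : Chains X →ₗ[ℚ] ℚ :=
  Finsupp.linearCombination ℚ fun s => if s.1 = 0 then 1 else 0

/-- The `0`-chain given by a point. -/
noncomputable def point (x : X) : Chains X := Finsupp.single ⟨0, ContinuousMap.const _ x⟩ 1

lemma aug_single (s : SingularSimplex X) (q : ℚ) :
    aug (Finsupp.single s q) = if s.1 = 0 then q else 0 := by
  simp [aug]

lemma aug_point (x : X) : aug (point x) = 1 := by
  simp [point, aug_single]

lemma bd_point (x : X) : bd (point x) = 0 := by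
  simp [point, simplexBoundary]

lemma point_mem_chainsIn {x : X} {Y : Set X} (h : x ∈ Y) : point x ∈ chainsIn Y := by
  refine single_mem_chainsIn ?_ _
  rintro _ ⟨t, rfl⟩
  exact h

lemma aug_bd (c : Chains X) : aug (bd c) = 0 := by
  suffices aug ∘ₗ bd = (0 : Chains X →ₗ[ℚ] ℚ) from LinearMap.congr_fun this c
  refine Finsupp.lhom_ext' fun s => LinearMap.ext_ring ?_
  obtain ⟨_ | _ | k, σ⟩ := s
  · simp [simplexBoundary]
  · simp [simplexBoundary, aug_single]
  · simp [simplexBoundary, aug_single]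

end Augmentation

section Star

variable {E : Type*} [AddCommGroup E] [Module ℝ E] [TopologicalSpace E] [ContinuousAdd E]
  [ContinuousSMul ℝ E]

lemma bd_coneOp (b : E) (c : Chains E) :
    bd (coneOp b c) + coneOp b (bd c) = c - aug c • point b := by
  suffices bd ∘ₗ coneOp b + coneOp b ∘ₗ bd = (LinearMap.id - aug.smulRight (point b) :
      Chains E →ₗ[ℚ] Chains E) from LinearMap.congr_fun this c
  refine Finsupp.lhom_ext' fun s => LinearMap.ext_ring ?_
  obtain ⟨_ | k, σ⟩ := s
  · have : ∀ σ : C(Simp 0, E), (coneSimplex b σ).comp (face 1) = ContinuousMap.const _ b :=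
      coneSimplex_face_one b
    simp [simplexBoundary, aug_single, coneSimplex_face_zero, point, this, sub_eq_add_neg]
  · simp only [LinearMap.comp_apply, Finsupp.lsingle_apply, LinearMap.add_apply, coneOp_single,
      bd_single, LinearMap.sub_apply, LinearMap.id_apply, LinearMap.smulRight_apply, aug_single,
      simplexBoundary, map_sum, map_smul]
    rw [Fin.sum_univ_succ, coneSimplex_face_zero]
    simp [coneSimplex_face_succ, pow_succ]

/-- A cycle in a star-shaped set is homologous to a multiple of a point. -/
lemma exists_eq_bd_of_starConvex {b : E} {Y : Set E} (hY : StarConvex ℝ b Y)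
    {c : Chains E} (hc : c ∈ chainsIn Y) (h : bd c = 0) :
    ∃ e ∈ chainsIn Y, c = bd e + aug c • point b := by
  refine ⟨coneOp b c, coneOp_mem_chainsIn hY hc, ?_⟩
  have := bd_coneOp b c
  rw [h, map_zero, add_zero] at this
  rw [this, sub_add_cancel]

end Star

section Graded

variable {X Y : Type*} [TopologicalSpace X] [TopologicalSpace Y]

/-- The singular chains of degree `k`. -/
def deg (k : ℕ) : Submodule ℚ (Chains X) := Finsupp.supported ℚ ℚ {s | s.1 = k}

/-- The projection onto the chains of degree `k`. -/
noncomputable def proj (k : ℕ) : Chains X →ₗ[ℚ] Chains X :=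
  Finsupp.linearCombination ℚ fun s => if s.1 = k then Finsupp.single s 1 else 0

lemma proj_single (k : ℕ) (s : SingularSimplex X) :
    proj k (Finsupp.single s 1) = if s.1 = k then Finsupp.single s 1 else 0 := by
  simp [proj]

lemma proj_mem_deg (k : ℕ) (c : Chains X) : proj k c ∈ deg k := by
  refine map_mem_of_mem_supported (S := Set.univ) (fun s _ => ?_) (fun _ _ => trivial)
  rw [proj_single]
  split_ifs with h
  · exact Finsupp.single_mem_supported _ _ h
  · exact zero_mem _

lemma proj_eq_self {k : ℕ} {c : Chains X} (hc : c ∈ deg k) : proj k c = c := by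
  have : (proj k - LinearMap.id : Chains X →ₗ[ℚ] Chains X) c ∈ (⊥ : Submodule ℚ (Chains X)) := by
    refine map_mem_of_mem_supported (fun s hs => ?_) hc
    rw [LinearMap.sub_apply, proj_single, if_pos (show s.1 = k from hs)]
    simp
  simpa [sub_eq_zero] using this

lemma bd_proj (k : ℕ) (c : Chains X) : bd (proj (k + 1) c) = proj k (bd c) := by
  suffices bd ∘ₗ proj (k + 1) = (proj k ∘ₗ bd : Chains X →ₗ[ℚ] Chains X) from
    LinearMap.congr_fun this c
  refine Finsupp.lhom_ext' fun s => LinearMap.ext_ring ?_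
  obtain ⟨_ | l, σ⟩ := s
  · simp [proj_single, simplexBoundary]
  · by_cases h : l = k <;> simp [proj_single, simplexBoundary, h, -Finsupp.smul_single]

lemma proj_mem_chainsIn (k : ℕ) {A : Set X} {c : Chains X} (hc : c ∈ chainsIn A) :
    proj k c ∈ chainsIn A := by
  refine map_mem_of_mem_chainsIn (fun s hs => ?_) hc
  rw [proj_single]
  split_ifs with h
  · exact single_mem_chainsIn hs 1
  · exact zero_mem _

lemma bd_mem_deg {k : ℕ} {c : Chains X} (hc : c ∈ deg (k + 1)) : bd c ∈ deg k := by
  rw [← proj_eq_self hc, bd_proj]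
  exact proj_mem_deg _ _

lemma point_mem_deg (x : X) : point x ∈ deg 0 := Finsupp.single_mem_supported _ _ rfl

lemma push_mem_deg (f : C(X, Y)) {k : ℕ} {c : Chains X} (hc : c ∈ deg k) : push f c ∈ deg k := by
  refine map_mem_of_mem_supported (fun s hs => ?_) hc
  rw [push_single]
  exact Finsupp.single_mem_supported _ _ hs

/-- Relative cycles of the pair `(X, X ∖ K)`. -/
noncomputable def relCycles (K : Set X) : Submodule ℚ (Chains X) := (chainsIn Kᶜ).comap bd

/-- Relative boundaries of the pair `(X, X ∖ K)`. -/
noncomputable def relBdries (K : Set X) : Submodule ℚ (Chains X) :=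
  LinearMap.range bd ⊔ chainsIn Kᶜ

lemma mem_relCycles {K : Set X} {c : Chains X} : c ∈ relCycles K ↔ bd c ∈ chainsIn Kᶜ := Iff.rfl

lemma mem_relBdries {K : Set X} {c : Chains X} :
    c ∈ relBdries K ↔ ∃ e, ∃ s ∈ chainsIn Kᶜ, c = bd e + s := by
  simp only [relBdries, Submodule.mem_sup, LinearMap.mem_range]
  constructor
  · rintro ⟨_, ⟨e, rfl⟩, s, hs, rfl⟩
    exact ⟨e, s, hs, rfl⟩
  · rintro ⟨e, s, hs, rfl⟩
    exact ⟨_, ⟨e, rfl⟩, s, hs, rfl⟩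

lemma bd_mem_relBdries (K : Set X) (e : Chains X) : bd e ∈ relBdries K :=
  Submodule.mem_sup_left ⟨e, rfl⟩

lemma chainsIn_le_relBdries (K : Set X) : chainsIn Kᶜ ≤ relBdries K := le_sup_right

lemma relCycles_anti {K K' : Set X} (h : K' ⊆ K) : relCycles K ≤ relCycles K' :=
  fun _ hc => chainsIn_mono (Set.compl_subset_compl.2 h) hc

lemma relBdries_anti {K K' : Set X} (h : K' ⊆ K) : relBdries K ≤ relBdries K' :=
  sup_le_sup_left (chainsIn_mono (Set.compl_subset_compl.2 h)) _

lemma mem_relCycles_of_bd_eq_zero {c : Chains X} (h : bd c = 0) (K : Set X) : c ∈ relCycles K := by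
  rw [mem_relCycles, h]
  exact zero_mem _

lemma exists_deg_of_mem_relBdries {K : Set X} {k : ℕ} {c : Chains X} (hk : c ∈ deg k)
    (hc : c ∈ relBdries K) :
    ∃ e ∈ deg (k + 1), ∃ s ∈ chainsIn Kᶜ, s ∈ deg k ∧ c = bd e + s := by
  obtain ⟨e, s, hs, h⟩ := mem_relBdries.1 hc
  refine ⟨proj (k + 1) e, proj_mem_deg _ _, proj k s, proj_mem_chainsIn k hs, proj_mem_deg _ _, ?_⟩
  rw [bd_proj, ← map_add, ← h, proj_eq_self hk]

/-- `z` generates the one-dimensional relative homology of `(X, X ∖ K)`. -/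
structure Generates (K : Set X) (z : Chains X) : Prop where
  mem : z ∈ relCycles K
  not_mem : z ∉ relBdries K
  span : ∀ c ∈ relCycles K, ∃ q : ℚ, c - q • z ∈ relBdries K

/-- The connecting homomorphism of the relative Mayer–Vietoris sequence preserves generators. -/
lemma Generates.inter {A B : Set X} (hA : IsClosed A) (hB : IsClosed B)
    (hZA : relCycles A ≤ relBdries A) (hZB : relCycles B ≤ relBdries B) {z a b : Chains X}
    (hz : Generates (A ∪ B) z) (ha : z - bd a ∈ chainsIn Aᶜ) (hb : z - bd b ∈ chainsIn Bᶜ) :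
    Generates (A ∩ B) (a - b) := by
  have hU : (A ∩ B)ᶜ = Aᶜ ∪ Bᶜ := Set.compl_inter _ _
  have hI : (A ∪ B)ᶜ = Aᶜ ∩ Bᶜ := Set.compl_union _ _
  have hAU : chainsIn Aᶜ ≤ chainsIn (A ∩ B)ᶜ := chainsIn_mono (by simp)
  have hBU : chainsIn Bᶜ ≤ chainsIn (A ∩ B)ᶜ := chainsIn_mono (by simp)
  have hIA : chainsIn (A ∪ B)ᶜ ≤ chainsIn Aᶜ := chainsIn_mono (by simp)
  have hIB : chainsIn (A ∪ B)ᶜ ≤ chainsIn Bᶜ := chainsIn_mono (by simp)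
  refine ⟨?_, ?_, ?_⟩
  · rw [mem_relCycles, map_sub, show bd a - bd b = (z - bd b) - (z - bd a) by abel]
    exact sub_mem (hBU hb) (hAU ha)
  · intro h
    obtain ⟨f, s, hs, h⟩ := mem_relBdries.1 h
    have hbs : bd s = (z - bd b) - (z - bd a) := by
      have := congrArg bd h
      rw [map_add, bd_bd, map_sub, zero_add] at this
      rw [← this]
      abel
    rw [hU] at hs
    obtain ⟨g, -, u, hu, v, hv, rfl⟩ := exists_eq_bd_add_add hA.isOpen_compl hB.isOpen_compl hs (by
      rw [hbs, sub_eq_add_neg, add_comm]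
      exact Submodule.add_mem_sup (neg_mem ha) hb)
    refine hz.not_mem (mem_relBdries.2 ⟨a - u, (z - bd a) + bd u, ?_, by rw [map_sub]; abel⟩)
    rw [hI]
    refine mem_chainsIn_inter (add_mem ha (bd_mem_chainsIn hu)) ?_
    have e : z - bd a + bd u = z - bd b - bd v := by
      rw [map_add, map_add, bd_bd, zero_add] at hbs
      rw [eq_sub_of_add_eq hbs]
      abel
    rw [e]
    exact sub_mem hb (bd_mem_chainsIn hv)
  · intro c hc
    rw [mem_relCycles, hU] at hc
    obtain ⟨g, hg, u, hu, v, hv, e⟩ := exists_eq_bd_add_add hA.isOpen_compl hB.isOpen_compl hc (by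
      rw [bd_bd]
      exact zero_mem _)
    have hbu : bd u = -bd v := by
      have := congrArg bd e
      rw [bd_bd, map_add, map_add, bd_bd, zero_add] at this
      exact eq_neg_of_add_eq_zero_left this.symm
    obtain ⟨q, hq⟩ := hz.span u (by
      rw [mem_relCycles, hI]
      refine mem_chainsIn_inter (bd_mem_chainsIn hu) ?_
      rw [hbu]
      exact neg_mem (bd_mem_chainsIn hv))
    obtain ⟨f, s, hs, h⟩ := mem_relBdries.1 hq
    have hf : bd f = u - q • z - s := eq_sub_of_add_eq h.symm
    have hx : q • a + f ∈ relBdries A := by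
      refine hZA ?_
      rw [mem_relCycles, map_add, map_smul, hf,
        show q • bd a + (u - q • z - s) = u - s - q • (z - bd a) by rw [smul_sub]; abel]
      exact sub_mem (sub_mem hu (hIA hs)) (Submodule.smul_mem _ _ ha)
    have hy : c - g - f - q • b ∈ relBdries B := by
      refine hZB ?_
      rw [mem_relCycles, map_sub, map_sub, map_sub, map_smul, hf, e,
        show bd g + u + v - bd g - (u - q • z - s) - q • bd b = v + s + q • (z - bd b) by
          rw [smul_sub]; abel]
      exact add_mem (add_mem hv (hIB hs)) (Submodule.smul_mem _ _ hb)
    refine ⟨-q, ?_⟩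
    rw [show c - (-q) • (a - b) = (q • a + f) + (c - g - f - q • b) + g by
      rw [neg_smul, smul_sub]; abel]
    refine add_mem (add_mem (relBdries_anti (by simp) hx) (relBdries_anti (by simp) hy))
      (chainsIn_le_relBdries _ ?_)
    rwa [hU]

end Graded

section Star

variable {E : Type*} [AddCommGroup E] [Module ℝ E] [TopologicalSpace E] [ContinuousAdd E]
  [ContinuousSMul ℝ E]

lemma relCycles_le_relBdries_of_starConvex {A : Set E} {b : E} (hb : b ∉ A)
    (hA : StarConvex ℝ b Aᶜ) : relCycles A ≤ relBdries A := by
  intro c hc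
  obtain ⟨e, he, h⟩ := exists_eq_bd_of_starConvex hA hc (bd_bd c)
  rw [aug_bd, zero_smul, add_zero] at h
  obtain ⟨f, -, h'⟩ := exists_eq_bd_of_starConvex (starConvex_univ b) (mem_chainsIn_univ (c - e))
    (by rw [map_sub, h, sub_self])
  refine mem_relBdries.2 ⟨f, aug (c - e) • point b + e, ?_, ?_⟩
  · exact add_mem (Submodule.smul_mem _ _ (point_mem_chainsIn hb)) he
  · rw [← add_assoc, ← h', sub_add_cancel]

lemma generates_univ (x : E) : Generates (Set.univ : Set E) (point x) := by
  have key : ∀ c : Chains E, c ∈ chainsIn (Set.univ : Set E)ᶜ ↔ c = 0 := fun c => by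
    rw [Set.compl_univ, chainsIn_empty, Submodule.mem_bot]
  refine ⟨mem_relCycles_of_bd_eq_zero (bd_point x) _, fun h => ?_, fun c hc => ?_⟩
  · obtain ⟨e, s, hs, h⟩ := mem_relBdries.1 h
    rw [(key s).1 hs, add_zero] at h
    have := aug_point x
    rw [h, aug_bd] at this
    exact zero_ne_one this
  · obtain ⟨e, -, h⟩ := exists_eq_bd_of_starConvex (starConvex_univ x) (mem_chainsIn_univ c)
      ((key _).1 hc)
    refine ⟨aug c, ?_⟩
    rw [← eq_sub_of_add_eq h.symm]
    exact bd_mem_relBdries _ _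

lemma relCycles_le_relBdries_halfSpace (V : Submodule ℝ E) (l : E →ₗ[ℝ] ℝ) {b : E} (hb : b ∈ V)
    (hlb : l b ≠ 0) (s : ℝ) :
    relCycles {x | x ∈ V ∧ s ≤ l x} ≤ relBdries {x | x ∈ V ∧ s ≤ l x} := by
  obtain ⟨b, hb, hlb⟩ : ∃ b ∈ V, l b < s :=
    ⟨((s - 1) / l b) • b, V.smul_mem _ hb, by
      rw [map_smul, smul_eq_mul, div_mul_cancel₀ _ hlb]
      linarith⟩
  refine relCycles_le_relBdries_of_starConvex (b := b) (fun h => absurd h.2 (not_le.2 hlb)) ?_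
  rintro y hy p q hp hq hpq ⟨h1, h2⟩
  have hy' : q • y ∈ V := by
    have := V.sub_mem h1 (V.smul_mem p hb)
    rwa [add_sub_cancel_left] at this
  rw [map_add, map_smul, map_smul, smul_eq_mul, smul_eq_mul] at h2
  rcases hq.eq_or_lt with rfl | hq
  · obtain rfl : p = 1 := by linarith
    linarith
  · refine hy ⟨(V.smul_mem_iff hq.ne').1 hy', ?_⟩
    obtain rfl : p = 1 - q := by linarith
    by_contra! h
    nlinarith

end Star

section Euclidean

variable {m : ℕ}

/-- The coordinate subspace on which the first `j` coordinates vanish. -/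
def coordSubspace (m j : ℕ) : Submodule ℝ (EuclideanSpace ℝ (Fin m)) where
  carrier := {x | ∀ i : Fin m, (i : ℕ) < j → x i = 0}
  add_mem' hx hy i hi := by simp [hx i hi, hy i hi]
  zero_mem' i _ := rfl
  smul_mem' r x hx i hi := by simp [hx i hi]

lemma mem_coordSubspace {j : ℕ} {x : EuclideanSpace ℝ (Fin m)} :
    x ∈ coordSubspace m j ↔ ∀ i : Fin m, (i : ℕ) < j → x i = 0 := Iff.rfl

lemma isClosed_coordSubspace (j : ℕ) :
    IsClosed (coordSubspace m j : Set (EuclideanSpace ℝ (Fin m))) := by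
  have : (coordSubspace m j : Set (EuclideanSpace ℝ (Fin m))) =
      ⋂ i : Fin m, ⋂ _ : (i : ℕ) < j, {x | x i = 0} := by
    ext x
    simp [mem_coordSubspace]
  rw [this]
  exact isClosed_iInter fun i => isClosed_iInter fun _ =>
    isClosed_eq (by fun_prop) continuous_const

/-- The part of a coordinate subspace above a value of the next coordinate. -/
def upper (j : Fin m) (s : ℝ) : Set (EuclideanSpace ℝ (Fin m)) :=
  {x | x ∈ coordSubspace m j ∧ s ≤ x j}

/-- The part of a coordinate subspace below a value of the next coordinate. -/
def lower (j : Fin m) (s : ℝ) : Set (EuclideanSpace ℝ (Fin m)) :=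
  {x | x ∈ coordSubspace m j ∧ x j ≤ s}

lemma isClosed_upper (j : Fin m) (s : ℝ) : IsClosed (upper j s) :=
  (isClosed_coordSubspace j).inter (isClosed_le continuous_const (EuclideanSpace.proj j).continuous)

lemma isClosed_lower (j : Fin m) (s : ℝ) : IsClosed (lower j s) :=
  (isClosed_coordSubspace j).inter (isClosed_le (EuclideanSpace.proj j).continuous continuous_const)

lemma single_mem_coordSubspace (j : Fin m) (r : ℝ) :
    EuclideanSpace.single j r ∈ coordSubspace m j := fun i hi => by
  have : i ≠ j := fun h => by simp [h] at hi
  simp [this]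

lemma relCycles_upper (j : Fin m) (s : ℝ) : relCycles (upper j s) ≤ relBdries (upper j s) :=
  relCycles_le_relBdries_halfSpace (coordSubspace m j) (EuclideanSpace.proj j).toLinearMap
    (single_mem_coordSubspace j 1) (by simp) s

lemma relCycles_lower (j : Fin m) (s : ℝ) : relCycles (lower j s) ≤ relBdries (lower j s) := by
  have := relCycles_le_relBdries_halfSpace (coordSubspace m j)
    (-(EuclideanSpace.proj j).toLinearMap) (single_mem_coordSubspace j 1) (by simp) (-s)
  have e : {x | x ∈ coordSubspace m j ∧
      -s ≤ (-(EuclideanSpace.proj (𝕜 := ℝ) j).toLinearMap) x} = lower j s := by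
    ext x
    simp [lower]
  rwa [e] at this

lemma upper_union_lower (j : Fin m) {s t : ℝ} (h : s ≤ t) :
    upper j s ∪ lower j t = coordSubspace m j := by
  ext x
  simp only [upper, lower, Set.mem_union, Set.mem_ofPred_eq, ← and_or_left, SetLike.mem_coe,
    and_iff_left_iff_imp]
  intro _
  rcases le_total s (x j) with h1 | h1
  · exact Or.inl h1
  · exact Or.inr (h1.trans h)

/-- A generator of the homology relative to the complement of a coordinate subspace gives rise to
generators relative to the complements of all segments in that direction. -/
lemma exists_generates_upper_inter_lower (j : Fin m) {k : ℕ} {z : Chains (EuclideanSpace ℝ (Fin m))}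
    (hk : z ∈ deg k) (hz : Generates (coordSubspace m j : Set (EuclideanSpace ℝ (Fin m))) z)
    (s t : ℝ) :
    ∃ w ∈ deg (k + 1), ∀ s' t', s ≤ s' → t' ≤ t → s' ≤ t' →
      Generates (upper j s' ∩ lower j t') w := by
  have ha : z ∈ relBdries (upper j s) :=
    relCycles_upper j s (relCycles_anti (fun x hx => hx.1) hz.mem)
  have hb : z ∈ relBdries (lower j t) :=
    relCycles_lower j t (relCycles_anti (fun x hx => hx.1) hz.mem)
  obtain ⟨a, hak, α, hα, -, ha⟩ := exists_deg_of_mem_relBdries hk ha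
  obtain ⟨b, hbk, β, hβ, -, hb⟩ := exists_deg_of_mem_relBdries hk hb
  refine ⟨a - b, sub_mem hak hbk, fun s' t' hs ht hst => ?_⟩
  refine Generates.inter (isClosed_upper _ _) (isClosed_lower _ _) (relCycles_upper _ _)
    (relCycles_lower _ _) (z := z) ?_ ?_ ?_
  · rwa [upper_union_lower j hst]
  · rw [ha, add_sub_cancel_left]
    exact chainsIn_mono (Set.compl_subset_compl.2
      (fun x hx => ⟨hx.1, hs.trans hx.2⟩ : upper j s' ⊆ upper j s)) hα
  · rw [hb, add_sub_cancel_left]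
    exact chainsIn_mono (Set.compl_subset_compl.2
      (fun x hx => ⟨hx.1, hx.2.trans ht⟩ : lower j t' ⊆ lower j t)) hβ

lemma upper_inter_lower_self (j : Fin m) :
    upper j 0 ∩ lower j 0 = coordSubspace m (j + 1) := by
  ext x
  simp only [upper, lower, Set.mem_inter_iff, Set.mem_ofPred_eq, SetLike.mem_coe, mem_coordSubspace]
  constructor
  · rintro ⟨⟨h1, h2⟩, -, h3⟩ i hi
    rcases (Nat.lt_succ_iff.1 hi).lt_or_eq with h | h
    · exact h1 i h
    · rw [Fin.ext h]
      exact le_antisymm h3 h2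
  · intro h
    exact ⟨⟨fun i hi => h i (by omega), (h j (by omega)).ge⟩, fun i hi => h i (by omega),
      (h j (by omega)).le⟩

lemma exists_generates_coordSubspace (j : ℕ) (hj : j ≤ m) :
    ∃ z ∈ deg j, Generates (coordSubspace m j : Set (EuclideanSpace ℝ (Fin m))) z := by
  induction j with
  | zero =>
    refine ⟨point 0, point_mem_deg _, ?_⟩
    have : (coordSubspace m 0 : Set (EuclideanSpace ℝ (Fin m))) = Set.univ := by
      ext x
      simp [mem_coordSubspace]
    rw [this]
    exact generates_univ 0
  | succ j ih =>
    obtain ⟨z, hk, hz⟩ := ih (by omega)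
    obtain ⟨w, hw, h⟩ := exists_generates_upper_inter_lower ⟨j, by omega⟩ hk hz 0 0
    refine ⟨w, hw, ?_⟩
    have := h 0 0 le_rfl le_rfl le_rfl
    rwa [upper_inter_lower_self] at this

/-- The segment from the origin to the last basis vector. -/
def lastSegment (n : ℕ) : Set (EuclideanSpace ℝ (Fin (n + 1))) :=
  upper (Fin.last n) 0 ∩ lower (Fin.last n) 1

lemma lastSegment_point (n : ℕ) (r : ℝ) :
    upper (Fin.last n) r ∩ lower (Fin.last n) r = {EuclideanSpace.single (Fin.last n) r} := by
  ext x
  simp only [upper, lower, Set.mem_inter_iff, Set.mem_ofPred_eq, mem_coordSubspace,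
    Set.mem_singleton_iff]
  constructor
  · rintro ⟨⟨h1, h2⟩, -, h3⟩
    ext i
    by_cases hi : i = Fin.last n
    · subst hi
      simpa using le_antisymm h3 h2
    · rw [h1 i (Fin.val_lt_last hi)]
      simp [hi]
  · rintro rfl
    have := single_mem_coordSubspace (Fin.last n) r
    exact ⟨⟨this, by simp⟩, this, by simp⟩

/-- A common generator for the homology relative to the complement of a segment and relative to the
complements of its end points. -/
lemma exists_generates_lastSegment (n : ℕ) :
    ∃ z ∈ deg (n + 1), Generates (lastSegment n) z ∧
      Generates {(0 : EuclideanSpace ℝ (Fin (n + 1)))} z ∧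
      Generates {EuclideanSpace.single (Fin.last n) (1 : ℝ)} z := by
  obtain ⟨z, hk, hz⟩ := exists_generates_coordSubspace (m := n + 1) n (by omega)
  obtain ⟨w, hw, h⟩ := exists_generates_upper_inter_lower (Fin.last n) hk hz 0 1
  refine ⟨w, hw, h 0 1 le_rfl le_rfl zero_le_one, ?_, ?_⟩
  · have := h 0 0 le_rfl zero_le_one le_rfl
    rwa [lastSegment_point, (by simp : EuclideanSpace.single (Fin.last n) (0 : ℝ) = 0)] at this
  · have := h 1 1 zero_le_one le_rfl le_rfl
    rwa [lastSegment_point] at this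

lemma isCompact_lastSegment (n : ℕ) : IsCompact (lastSegment n) := by
  refine Metric.isCompact_of_isClosed_isBounded
    ((isClosed_upper _ _).inter (isClosed_lower _ _)) ?_
  refine (Metric.isBounded_closedBall (x := 0) (r := 1)).subset ?_
  rintro x ⟨⟨h1, h2⟩, -, h3⟩
  have : x = EuclideanSpace.single (Fin.last n) (x (Fin.last n)) := by
    have := lastSegment_point n (x (Fin.last n))
    exact this.subset ⟨⟨h1, le_rfl⟩, h1, le_rfl⟩
  rw [mem_closedBall_zero_iff, this]
  simp [abs_le, h3]
  linarith

end Euclidean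

section Excision

lemma mapsTo_compl_image {α β : Type*} {f : α → β} (hf : Function.Injective f) (D : Set α) :
    Set.MapsTo f Dᶜ (f '' D)ᶜ := fun _ hx h => hx (hf.mem_set_image.1 h)

variable {X Y : Type*} [TopologicalSpace X] [TopologicalSpace Y]

lemma simplexMap_injective {f : C(X, Y)} (hf : Function.Injective f) :
    Function.Injective fun s : SingularSimplex X => (⟨s.1, f.comp s.2⟩ : SingularSimplex Y) := by
  rintro ⟨k, σ⟩ ⟨l, τ⟩ h
  obtain rfl : k = l := congrArg Sigma.fst h
  have h2 : f.comp σ = f.comp τ := eq_of_heq (Sigma.mk.inj h).2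
  have : σ = τ := ContinuousMap.ext fun t => hf (DFunLike.congr_fun h2 t)
  rw [this]

lemma push_injective {f : C(X, Y)} (hf : Function.Injective f) : Function.Injective (push f) :=
  Finsupp.mapDomain_injective (simplexMap_injective hf)

lemma mem_chainsIn_of_push {f : C(X, Y)} (hf : Function.Injective f) {B : Set Y} {c : Chains X}
    (h : push f c ∈ chainsIn B) : c ∈ chainsIn (f ⁻¹' B) := by
  classical
  intro s hs
  have : (⟨s.1, f.comp s.2⟩ : SingularSimplex Y) ∈ (push f c).support := by
    change _ ∈ (Finsupp.mapDomain _ c).support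
    rw [Finsupp.mapDomain_support_of_injective (simplexMap_injective hf)]
    exact Finset.mem_image_of_mem _ hs
  rintro _ ⟨t, rfl⟩
  exact h this ⟨t, rfl⟩

lemma exists_push_eq {f : C(X, Y)} (hf : Topology.IsEmbedding f) {A : Set X} {c : Chains Y}
    (hc : c ∈ chainsIn (f '' A)) : ∃ c' ∈ chainsIn A, push f c' = c := by
  suffices (LinearMap.id : Chains Y →ₗ[ℚ] Chains Y) c ∈ (chainsIn A).map (push f) by
    simpa using this
  refine map_mem_of_mem_chainsIn (fun s hs => ?_) hc
  choose g hgA hg using fun t => hs ⟨t, rfl⟩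
  have hgc : Continuous g := by
    rw [hf.continuous_iff]
    convert s.2.continuous using 1
    exact funext hg
  refine ⟨Finsupp.single ⟨s.1, g, hgc⟩ 1, single_mem_chainsIn ?_ _, ?_⟩
  · rintro _ ⟨t, rfl⟩
    exact hgA t
  · rw [push_single]
    have : f.comp ⟨g, hgc⟩ = s.2 := ContinuousMap.ext hg
    rw [this]
    rfl

lemma push_mem_relBdries {f : C(X, Y)} (hf : Function.Injective f) {D : Set X} {c : Chains X}
    (hc : c ∈ relBdries D) : push f c ∈ relBdries (f '' D) := by
  obtain ⟨e, s, hs, rfl⟩ := mem_relBdries.1 hc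
  refine mem_relBdries.2 ⟨push f e, push f s, ?_, by rw [map_add, bd_push]⟩
  exact push_mem_chainsIn f (mapsTo_compl_image hf D) hs

lemma proj_mem_relBdries {D : Set X} (k : ℕ) {c : Chains X} (hc : c ∈ relBdries D) :
    proj k c ∈ relBdries D := by
  obtain ⟨e, s, hs, rfl⟩ := mem_relBdries.1 hc
  exact mem_relBdries.2 ⟨proj (k + 1) e, proj k s, proj_mem_chainsIn k hs, by
    rw [map_add, bd_proj]⟩

/-- Excision for generators of relative homology. -/
lemma Generates.push {f : C(X, Y)} (hf : Topology.IsOpenEmbedding f) {D : Set X}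
    (hD : IsClosed (f '' D)) {z : Chains X} (hz : Generates D z) :
    Generates (f '' D) (push f z) := by
  have hpre : f ⁻¹' (f '' D)ᶜ = Dᶜ := by
    rw [Set.preimage_compl, Set.preimage_image_eq _ hf.injective]
  have huniv : Set.range f ∪ (f '' D)ᶜ = Set.univ := by
    refine Set.eq_univ_of_forall fun y => ?_
    by_cases h : y ∈ f '' D
    · exact Or.inl (Set.image_subset_range _ _ h)
    · exact Or.inr h
  have hmem : ∀ c : Chains Y, c ∈ chainsIn (Set.range f ∪ (f '' D)ᶜ) := fun c => by
    rw [huniv]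
    exact mem_chainsIn_univ c
  have hrange : Set.range f = f '' Set.univ := Set.image_univ.symm
  refine ⟨?_, fun h => ?_, fun c hc => ?_⟩
  · rw [mem_relCycles, bd_push]
    exact push_mem_chainsIn f (mapsTo_compl_image hf.injective D) hz.mem
  · obtain ⟨e, s, hs, h⟩ := mem_relBdries.1 h
    obtain ⟨g, -, u, hu, v, hv, he⟩ := exists_eq_bd_add_add hf.isOpen_range hD.isOpen_compl
      (hmem e) (by
        rw [← sub_eq_of_eq_add h, sub_eq_add_neg]
        exact Submodule.add_mem_sup
          (push_mem_chainsIn f (Set.mapsTo_range f Set.univ) (mem_chainsIn_univ z)) (neg_mem hs))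
    rw [hrange] at hu
    obtain ⟨u, -, rfl⟩ := exists_push_eq hf.isEmbedding hu
    refine hz.not_mem (mem_relBdries.2 ⟨u, z - bd u, ?_, by abel⟩)
    rw [← hpre]
    refine mem_chainsIn_of_push hf.injective ?_
    rw [map_sub, ← bd_push, h, he, map_add, map_add, bd_bd, zero_add]
    rw [show bd (SingularChains.push f u) + bd v + s - bd (SingularChains.push f u) = bd v + s by
      abel]
    exact add_mem (bd_mem_chainsIn hv) hs
  · obtain ⟨g, -, u, hu, v, hv, he⟩ := exists_eq_bd_add_add hf.isOpen_range hD.isOpen_compl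
      (hmem c) (Submodule.mem_sup_right hc)
    rw [hrange] at hu
    obtain ⟨u, -, rfl⟩ := exists_push_eq hf.isEmbedding hu
    obtain ⟨q, hq⟩ := hz.span u (by
      rw [mem_relCycles, ← hpre]
      refine mem_chainsIn_of_push hf.injective ?_
      rw [← bd_push]
      have : bd (SingularChains.push f u) = bd c - bd v := by
        rw [he, map_add, map_add, bd_bd]
        abel
      rw [this]
      exact sub_mem hc (bd_mem_chainsIn hv))
    refine ⟨q, ?_⟩
    have := push_mem_relBdries hf.injective hq
    rw [map_sub, map_smul] at this
    rw [he, show bd g + SingularChains.push f u + v - q • SingularChains.push f z =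
      bd g + (SingularChains.push f u - q • SingularChains.push f z) + v by abel]
    exact add_mem (add_mem (bd_mem_relBdries _ _) this) (chainsIn_le_relBdries _ hv)

lemma Generates.mem_relBdries_of_ne {K : Set X} {z : Chains X} {k l : ℕ} (hz : Generates K z)
    (hk : z ∈ deg k) (hl : l ≠ k) {c : Chains X} (hc : c ∈ relCycles K) (hcl : c ∈ deg l) :
    c ∈ relBdries K := by
  obtain ⟨q, hq⟩ := hz.span c hc
  have h0 : proj l z = 0 := by
    rw [← Submodule.mem_bot (R := ℚ)]
    refine map_mem_of_mem_supported (fun s hs => ?_) hk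
    rw [proj_single, if_neg (fun h => hl (h.symm.trans hs))]
    exact zero_mem _
  have := proj_mem_relBdries l hq
  rwa [map_sub, map_smul, h0, smul_zero, sub_zero, proj_eq_self hcl] at this

end Excision

section Manifold

variable {n : ℕ} {N : Type*} [TopologicalSpace N]

lemma exists_isOpenEmbedding [ChartedSpace (EuclideanSpace ℝ (Fin (n + 1))) N] {U : Set N}
    (hU : IsOpen U) {x : N} (hx : x ∈ U) :
    ∃ f : C(EuclideanSpace ℝ (Fin (n + 1)), N),
      Topology.IsOpenEmbedding f ∧ f 0 = x ∧ Set.range f ⊆ U := by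
  set e := chartAt (EuclideanSpace ℝ (Fin (n + 1))) x
  have hxe : x ∈ e.source := mem_chart_source _ x
  obtain ⟨r, hr, hball⟩ := Metric.isOpen_iff.1 (e.symm.isOpen_inter_preimage hU) (e x)
    ⟨e.map_source hxe, by simpa [e.left_inv hxe] using hx⟩
  have hsub : Metric.ball (e x) r ⊆ e.target := hball.trans Set.inter_subset_left
  set b := OpenPartialHomeomorph.univBall (e x) r
  have hb : ∀ y, b y ∈ Metric.ball (e x) r := fun y => by
    rw [← OpenPartialHomeomorph.univBall_target (e x) hr]
    exact b.map_source (by simp [b])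
  have hsrc : (b.trans e.symm).source = Set.univ := by
    refine Set.eq_univ_of_forall fun y => ?_
    rw [OpenPartialHomeomorph.trans_source]
    exact ⟨by simp [b], hsub (hb y)⟩
  have hf := (b.trans e.symm).isOpenEmbedding hsrc
  refine ⟨⟨_, hf.continuous⟩, hf, ?_, ?_⟩
  · change e.symm (b 0) = x
    rw [OpenPartialHomeomorph.univBall_apply_zero, e.left_inv hxe]
  · rintro _ ⟨y, rfl⟩
    exact (hball (hb y)).2

lemma exists_homeomorph {p q : EuclideanSpace ℝ (Fin (n + 1))} (h : p ≠ q) :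
    ∃ φ : EuclideanSpace ℝ (Fin (n + 1)) ≃ₜ EuclideanSpace ℝ (Fin (n + 1)),
      φ 0 = p ∧ φ (EuclideanSpace.single (Fin.last n) 1) = q := by
  obtain ⟨A, hA⟩ := SeparatingDual.exists_continuousLinearEquiv_apply_eq (R := ℝ)
    (x := EuclideanSpace.single (Fin.last n) (1 : ℝ)) (y := q - p) (by simp)
    (sub_ne_zero.2 h.symm)
  exact ⟨A.toHomeomorph.trans (Homeomorph.addLeft p), by simp, by simp [hA]⟩

variable [T2Space N]

lemma exists_generates_image_segment {f : C(EuclideanSpace ℝ (Fin (n + 1)), N)}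
    (hf : Topology.IsOpenEmbedding f) :
    ∃ z ∈ deg (n + 1), z ∈ chainsIn (Set.range f) ∧ Generates (f '' lastSegment n) z ∧
      Generates {f 0} z ∧ Generates {f (EuclideanSpace.single (Fin.last n) 1)} z := by
  obtain ⟨z, hk, h1, h2, h3⟩ := exists_generates_lastSegment n
  refine ⟨push f z, push_mem_deg f hk,
    push_mem_chainsIn f (Set.mapsTo_range f Set.univ) (mem_chainsIn_univ z),
    h1.push hf ((isCompact_lastSegment n).image f.continuous).isClosed, ?_, ?_⟩
  · have := h2.push hf (by simp)
    rwa [Set.image_singleton] at this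
  · have := h3.push hf (by simp)
    rwa [Set.image_singleton] at this

lemma exists_generates_singleton [ChartedSpace (EuclideanSpace ℝ (Fin (n + 1))) N] {U : Set N}
    (hU : IsOpen U) {x : N} (hx : x ∈ U) :
    ∃ z ∈ deg (n + 1), z ∈ chainsIn U ∧ Generates {x} z := by
  obtain ⟨f, hf, rfl, hfU⟩ := exists_isOpenEmbedding (n := n) hU hx
  obtain ⟨z, hk, hz, -, h, -⟩ := exists_generates_image_segment hf
  exact ⟨z, hk, chainsIn_mono hfU hz, h⟩

lemma mem_relBdries_singleton_of_ne [ChartedSpace (EuclideanSpace ℝ (Fin (n + 1))) N] {k : ℕ}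
    (hk : k ≠ n + 1) {x : N} {c : Chains N} (hc : c ∈ deg k) (h : c ∈ relCycles {x}) :
    c ∈ relBdries {x} := by
  obtain ⟨z, hz, -, hg⟩ := exists_generates_singleton (n := n) isOpen_univ (Set.mem_univ x)
  exact hg.mem_relBdries_of_ne hz hk h hc

lemma mem_relBdries_of_mem_range {f : C(EuclideanSpace ℝ (Fin (n + 1)), N)}
    (hf : Topology.IsOpenEmbedding f) {c : Chains N} (hc : bd c = 0)
    {p q : EuclideanSpace ℝ (Fin (n + 1))} (h : c ∈ relBdries {f p}) : c ∈ relBdries {f q} := by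
  obtain rfl | hpq := eq_or_ne p q
  · exact h
  obtain ⟨φ, rfl, rfl⟩ := exists_homeomorph hpq
  obtain ⟨z, -, -, h1, h2, h3⟩ := exists_generates_image_segment
    (f := f.comp ⟨φ, φ.continuous⟩) (hf.comp φ.isOpenEmbedding)
  have m0 : f (φ 0) ∈ f.comp ⟨φ, φ.continuous⟩ '' lastSegment n :=
    ⟨0, by simp [lastSegment, upper, lower], rfl⟩
  have m1 : f (φ (EuclideanSpace.single (Fin.last n) 1)) ∈
      f.comp ⟨φ, φ.continuous⟩ '' lastSegment n :=
    ⟨EuclideanSpace.single (Fin.last n) 1, by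
      simpa [lastSegment, upper, lower] using single_mem_coordSubspace (Fin.last n) 1, rfl⟩
  obtain ⟨r, hr⟩ := h1.span c (mem_relCycles_of_bd_eq_zero hc _)
  have hrz : r • z ∈ relBdries {f (φ 0)} := by
    have := sub_mem h (relBdries_anti (Set.singleton_subset_iff.2 m0) hr)
    rwa [sub_sub_cancel] at this
  obtain rfl : r = 0 := by
    by_contra hr0
    exact h2.not_mem ((Submodule.smul_mem_iff _ hr0).1 hrz)
  rw [zero_smul, sub_zero] at hr
  exact relBdries_anti (Set.singleton_subset_iff.2 m1) hr

/-- On a connected manifold, a cycle which is locally trivial at one point is locally trivial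
everywhere. -/
lemma mem_relBdries_of_connected [ChartedSpace (EuclideanSpace ℝ (Fin (n + 1))) N]
    [ConnectedSpace N] {c : Chains N} (hc : bd c = 0) {x : N} (hx : c ∈ relBdries {x}) (y : N) :
    c ∈ relBdries {y} := by
  have hclopen : IsClopen {y : N | c ∈ relBdries {y}} := by
    refine ⟨⟨isOpen_iff_mem_nhds.2 fun y hy => ?_⟩, isOpen_iff_mem_nhds.2 fun y hy => ?_⟩ <;>
    obtain ⟨f, hf, rfl, -⟩ := exists_isOpenEmbedding (n := n) isOpen_univ (Set.mem_univ y) <;>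
    refine Filter.mem_of_superset (hf.isOpen_range.mem_nhds ⟨0, rfl⟩) ?_ <;>
    rintro _ ⟨q, rfl⟩
    · exact fun h => hy (mem_relBdries_of_mem_range hf hc h)
    · exact mem_relBdries_of_mem_range hf hc hy
  exact (hclopen.eq_univ ⟨x, hx⟩).ge (Set.mem_univ y)

end Manifold

section Sweep

variable {N P : Type*} [TopologicalSpace N]

/-- A local-to-global principle: a property `Φ` of compact sets, depending on a parameter, which
can be glued from two compact sets to their union as soon as it holds for all admissible parameters
on the intersection. -/
structure GluingPrinciple (compat Φ : P → Set N → Prop) : Prop where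
  compat_anti : ∀ p K L, L ⊆ K → compat p K → compat p L
  anti : ∀ p K L, L ⊆ K → Φ p K → Φ p L
  glue : ∀ p K L, IsCompact K → IsCompact L → compat p (K ∪ L) → Φ p K → Φ p L →
    (∀ q, compat q (K ∩ L) → Φ q (K ∩ L)) → Φ p (K ∪ L)
  spread : ∀ p K, IsCompact K → Φ p K → ∃ V, IsOpen V ∧ K ⊆ V ∧ ∀ L ⊆ V, IsCompact L →
    compat p L → Φ p L
  empty : ∀ p, compat p ∅ → Φ p ∅
  point : ∀ p x, compat p {x} → Φ p {x}

variable {compat Φ : P → Set N → Prop}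

lemma GluingPrinciple.exists_forall_slab (h : GluingPrinciple compat Φ) {K : Set N}
    (hK : IsCompact K) {F : N → ℝ} (hF : ContinuousOn F K)
    {p : P} (hp : compat p K) {t : ℝ} (ht : Φ p (K ∩ F ⁻¹' {t}))
    (htc : IsCompact (K ∩ F ⁻¹' {t})) :
    ∃ ε > 0, ∀ L ⊆ K, IsCompact L → (∀ x ∈ L, |F x - t| < ε) → Φ p L := by
  obtain ⟨V, hV, hKV, hVΦ⟩ := h.spread p _ htc ht
  have hc : IsClosed (F '' (K \ V)) :=
    ((hK.diff hV).image_of_continuousOn (hF.mono Set.sdiff_subset)).isClosed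
  have hnot : t ∈ (F '' (K \ V))ᶜ := by
    rintro ⟨x, ⟨hx, hxV⟩, hxt⟩
    exact hxV (hKV ⟨hx, hxt⟩)
  obtain ⟨ε, hε, hball⟩ := Metric.isOpen_iff.1 hc.isOpen_compl t hnot
  refine ⟨ε, hε, fun L hL hLc hLt => hVΦ L (fun x hx => ?_) hLc (h.compat_anti _ _ _ hL hp)⟩
  by_contra hxV
  exact hball (show F x ∈ Metric.ball t ε by
    rw [Metric.mem_ball, Real.dist_eq]
    exact hLt x hx) ⟨x, ⟨hL hx, hxV⟩, rfl⟩

variable [T2Space N]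

/-- Sweeping out a compact set by the level sets of a continuous function. -/
lemma GluingPrinciple.of_levels (h : GluingPrinciple compat Φ) {K : Set N} (hK : IsCompact K)
    {F : N → ℝ} (hF : ContinuousOn F K)
    (hlev : ∀ t, ∀ L ⊆ K ∩ F ⁻¹' {t}, IsCompact L → ∀ p, compat p L → Φ p L)
    {p : P} (hp : compat p K) : Φ p K := by
  have hcl : ∀ S : Set ℝ, IsClosed S → IsCompact (K ∩ F ⁻¹' S) := fun S hS =>
    hK.of_isClosed_subset (hF.preimage_isClosed_of_isClosed hK.isClosed hS) Set.inter_subset_left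
  set T : Set ℝ := {t | Φ p (K ∩ F ⁻¹' Set.Iic t)}
  have hdown : ∀ s t, s ≤ t → t ∈ T → s ∈ T := fun s t hst ht => h.anti _ _ _
    (Set.inter_subset_inter_right _ (Set.preimage_mono (Set.Iic_subset_Iic.2 hst))) ht
  have hloc : ∀ t, ∃ ε > 0, ∀ s s', |s - t| < ε → |s' - t| < ε → s ∈ T → s' ∈ T := by
    intro t
    obtain ⟨ε, hε, hslab⟩ := h.exists_forall_slab hK hF hp
      (hlev t _ subset_rfl (hcl _ isClosed_singleton) p
        (h.compat_anti _ _ _ Set.inter_subset_left hp)) (hcl _ isClosed_singleton)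
    refine ⟨ε, hε, fun s s' hs hs' hsT => ?_⟩
    rcases le_total s' s with hle | hle
    · exact hdown _ _ hle hsT
    · have hunion : K ∩ F ⁻¹' Set.Iic s' = (K ∩ F ⁻¹' Set.Iic s) ∪ (K ∩ F ⁻¹' Set.Icc s s') := by
        rw [← Set.inter_union_distrib_left, ← Set.preimage_union, Set.Iic_union_Icc_eq_Iic hle]
      change Φ p _
      rw [hunion]
      refine h.glue p _ _ (hcl _ isClosed_Iic) (hcl _ isClosed_Icc)
        (h.compat_anti _ _ _ (Set.union_subset Set.inter_subset_left Set.inter_subset_left) hp)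
        hsT (hslab _ Set.inter_subset_left (hcl _ isClosed_Icc) ?_) (fun q hq => ?_)
      · rintro x ⟨-, h1, h2⟩
        rw [abs_lt] at hs hs' ⊢
        constructor <;> linarith
      · refine hlev s _ ?_ ((hcl _ isClosed_Iic).inter (hcl _ isClosed_Icc)) q hq
        rintro x ⟨⟨h1, h2⟩, -, h3, -⟩
        exact ⟨h1, le_antisymm h2 h3⟩
  have hclopen : IsClopen T := by
    refine ⟨⟨isOpen_iff_mem_nhds.2 fun t ht => ?_⟩, isOpen_iff_mem_nhds.2 fun t ht => ?_⟩ <;>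
    obtain ⟨ε, hε, hε'⟩ := hloc t <;>
    refine Filter.mem_of_superset (Metric.ball_mem_nhds t hε) fun s hs => ?_ <;>
    rw [Metric.mem_ball, Real.dist_eq] at hs
    · exact fun hsT => ht (hε' s t hs (by simpa using hε) hsT)
    · exact hε' t s (by simpa using hε) hs ht
  have hbdd : Bornology.IsBounded (F '' K) := (hK.image_of_continuousOn hF).isBounded
  obtain ⟨a, ha⟩ := hbdd.bddBelow
  obtain ⟨b, hb⟩ := hbdd.bddAbove
  have hTne : T.Nonempty := by
    refine ⟨a - 1, ?_⟩
    have : K ∩ F ⁻¹' Set.Iic (a - 1) = ∅ := by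
      refine Set.eq_empty_of_forall_notMem ?_
      rintro x ⟨hx, hxa⟩
      have h1 := ha ⟨x, hx, rfl⟩
      have h2 : F x ≤ a - 1 := hxa
      linarith
    change Φ p _
    rw [this]
    exact h.empty p (h.compat_anti _ _ _ (Set.empty_subset _) hp)
  have hbT : b ∈ T := (hclopen.eq_univ hTne).ge (Set.mem_univ b)
  have : K ∩ F ⁻¹' Set.Iic b = K :=
    Set.inter_eq_left.2 fun x hx => hb ⟨x, hx, rfl⟩
  change Φ p _ at hbT
  rwa [this] at hbT

lemma GluingPrinciple.of_subset_range (h : GluingPrinciple compat Φ) {m : ℕ}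
    {f : C(EuclideanSpace ℝ (Fin m), N)} (hf : Topology.IsOpenEmbedding f)
    {K : Set N} (hK : IsCompact K) (hKf : K ⊆ Set.range f) {p : P} (hp : compat p K) : Φ p K := by
  obtain ⟨g, hg, hgf⟩ : ∃ g : N → EuclideanSpace ℝ (Fin m), ContinuousOn g (Set.range f) ∧
      ∀ x, g (f x) = x := by
    refine ⟨(hf.toOpenPartialHomeomorph f).symm, ?_, fun x => ?_⟩
    · have := (hf.toOpenPartialHomeomorph f).continuousOn_symm
      rwa [hf.toOpenPartialHomeomorph_target] at this
    · exact (hf.toOpenPartialHomeomorph f).left_inv (by simp)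
  suffices ∀ j ≤ m, ∀ L : Set N, IsCompact L → L ⊆ Set.range f →
      (∀ x ∈ L, ∀ y ∈ L, ∀ i : Fin m, (i : ℕ) < j → g x i = g y i) → ∀ p, compat p L → Φ p L from
    this 0 (Nat.zero_le _) K hK hKf (fun _ _ _ _ i hi => absurd hi (Nat.not_lt_zero _)) p hp
  intro j hj
  induction hj using Nat.decreasingInduction with
  | self =>
    intro L _ hLf hL p hp
    rcases L.eq_empty_or_nonempty with rfl | ⟨x, hx⟩
    · exact h.empty p hp
    · obtain rfl : L = {x} := by
        refine Set.Subset.antisymm (fun y hy => ?_) (Set.singleton_subset_iff.2 hx)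
        obtain ⟨x, rfl⟩ := hLf hx
        obtain ⟨y, rfl⟩ := hLf hy
        have : g (f y) = g (f x) := by
          ext i
          exact hL _ hy _ hx i i.2
        rw [hgf, hgf] at this
        rw [this]
        rfl
      exact h.point p x hp
  | of_succ j hj ih =>
    intro L hLc hLf hL p hp
    refine h.of_levels hLc (F := fun x => g x ⟨j, hj⟩) ?_ (fun t M hM hMc => ?_) hp
    · exact (EuclideanSpace.proj (𝕜 := ℝ) (⟨j, hj⟩ : Fin m)).continuous.comp_continuousOn
        (hg.mono hLf)
    · refine ih M hMc (fun x hx => hLf (hM hx).1) fun x hx y hy i hi => ?_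
      rcases (Nat.lt_succ_iff.1 hi).lt_or_eq with h' | h'
      · exact hL x (hM hx).1 y (hM hy).1 i h'
      · obtain rfl : i = ⟨j, hj⟩ := Fin.ext h'
        exact (hM hx).2.trans (hM hy).2.symm

/-- On a manifold, a gluing principle holds for all compact sets. -/
theorem GluingPrinciple.of_isCompact {n : ℕ} [ChartedSpace (EuclideanSpace ℝ (Fin (n + 1))) N]
    (h : GluingPrinciple compat Φ) {K : Set N} (hK : IsCompact K) {p : P} (hp : compat p K) :
    Φ p K := by
  suffices ∀ L ⊆ closure K, IsCompact L → ∀ p, compat p L → Φ p L from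
    this K subset_closure hK p hp
  refine hK.induction_on (p := fun s => ∀ L ⊆ closure s, IsCompact L → ∀ p, compat p L → Φ p L)
    ?_ ?_ ?_ ?_
  · intro L hL _ p hp
    rw [closure_empty, Set.subset_empty_iff] at hL
    subst hL
    exact h.empty p hp
  · exact fun s t hst ht L hL => ht L (hL.trans (closure_mono hst))
  · intro s t hs ht L hL hLc p hp
    rw [closure_union] at hL
    have hunion : L = (L ∩ closure s) ∪ (L ∩ closure t) := by
      rw [← Set.inter_union_distrib_left, Set.inter_eq_left.2 hL]
    have h1 := hLc.inter_right (isClosed_closure (s := s))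
    have h2 := hLc.inter_right (isClosed_closure (s := t))
    rw [hunion] at hp ⊢
    exact h.glue p _ _ h1 h2 hp
      (hs _ Set.inter_subset_right h1 p (h.compat_anti _ _ _ Set.subset_union_left hp))
      (ht _ Set.inter_subset_right h2 p (h.compat_anti _ _ _ Set.subset_union_right hp))
      fun q hq => hs _ (Set.inter_subset_left.trans Set.inter_subset_right) (h1.inter h2) q hq
  · intro x _
    obtain ⟨f, hf, rfl, -⟩ := exists_isOpenEmbedding (n := n) isOpen_univ (Set.mem_univ x)
    have hc : IsCompact (f '' Metric.closedBall 0 1) :=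
      (isCompact_closedBall _ _).image f.continuous
    refine ⟨f '' Metric.closedBall 0 1, mem_nhdsWithin_of_mem_nhds
      (hf.isOpenMap.image_mem_nhds (Metric.closedBall_mem_nhds _ one_pos)), ?_⟩
    intro L hL hLc p hp
    rw [hc.isClosed.closure_eq] at hL
    exact h.of_subset_range hf hLc (hL.trans (Set.image_subset_range _ _)) hp

end Sweep

lemma exists_isOpen_mem_relBdries {X : Type*} [TopologicalSpace X] [T2Space X] {K : Set X}
    {c : Chains X} (hc : c ∈ relBdries K) : ∃ V, IsOpen V ∧ K ⊆ V ∧ c ∈ relBdries V := by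
  obtain ⟨e, s, hs, rfl⟩ := mem_relBdries.1 hc
  have hC : IsCompact (⋃ σ ∈ s.support, Set.range σ.2) :=
    s.support.isCompact_biUnion fun σ _ => isCompact_range σ.2.continuous
  refine ⟨_, hC.isClosed.isOpen_compl, ?_, mem_relBdries.2 ⟨e, s, ?_, rfl⟩⟩
  · rw [Set.subset_compl_comm]
    exact Set.iUnion₂_subset fun σ hσ => hs hσ
  · rw [compl_compl]
    exact fun σ hσ => Set.subset_biUnion_of_mem (u := fun σ : SingularSimplex X => Set.range σ.2) hσ

section Gluing

variable {X : Type*} [TopologicalSpace X]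

/-- Gluing of relative null-homologies. -/
lemma mem_relBdries_union {K L : Set X} (hK : IsClosed K) (hL : IsClosed L) {k : ℕ} {c : Chains X}
    (hk : c ∈ deg k) (hcK : c ∈ relBdries K) (hcL : c ∈ relBdries L)
    (h : ∀ d ∈ deg (k + 1), d ∈ relCycles (K ∩ L) → d ∈ relBdries (K ∩ L)) :
    c ∈ relBdries (K ∪ L) := by
  have hU : (K ∩ L)ᶜ = Kᶜ ∪ Lᶜ := Set.compl_inter _ _
  obtain ⟨e₁, he₁, s₁, hs₁, -, h₁⟩ := exists_deg_of_mem_relBdries hk hcK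
  obtain ⟨e₂, he₂, s₂, hs₂, -, h₂⟩ := exists_deg_of_mem_relBdries hk hcL
  have hd : bd (e₁ - e₂) = s₂ - s₁ := by
    rw [map_sub, eq_sub_of_add_eq h₁.symm, eq_sub_of_add_eq h₂.symm]
    abel
  obtain ⟨f, s, hs, hfs⟩ := mem_relBdries.1 (h (e₁ - e₂) (sub_mem he₁ he₂) (by
    rw [mem_relCycles, hd]
    exact sub_mem (chainsIn_mono (by simp) hs₂) (chainsIn_mono (by simp) hs₁)))
  have hbs : bd s = s₂ - s₁ := by
    rw [← hd, hfs, map_add, bd_bd, zero_add]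
  rw [hU] at hs
  obtain ⟨g, -, u, hu, v, hv, rfl⟩ := exists_eq_bd_add_add hK.isOpen_compl hL.isOpen_compl hs (by
    rw [hbs, sub_eq_add_neg, add_comm]
    exact Submodule.add_mem_sup (neg_mem hs₁) hs₂)
  rw [map_add, map_add, bd_bd, zero_add] at hbs
  refine mem_relBdries.2 ⟨e₁ - u, s₁ + bd u, ?_, by rw [h₁, map_sub]; abel⟩
  rw [Set.compl_union]
  refine mem_chainsIn_inter (add_mem hs₁ (bd_mem_chainsIn hu)) ?_
  rw [show s₁ + bd u = s₂ - bd v by rw [eq_sub_of_add_eq hbs]; abel]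
  exact sub_mem hs₂ (bd_mem_chainsIn hv)

lemma mem_relBdries_empty (c : Chains X) : c ∈ relBdries (∅ : Set X) := by
  refine chainsIn_le_relBdries _ ?_
  rw [Set.compl_empty]
  exact mem_chainsIn_univ c

/-- A relative null-homology for a finite set of points is a collection of relative null-homologies
for the points. -/
lemma mem_relBdries_of_finite [T1Space X] {A : Set X} (hA : A.Finite) {k : ℕ} {c : Chains X}
    (hk : c ∈ deg k) (h : ∀ x ∈ A, c ∈ relBdries {x}) :
    c ∈ relBdries A := by
  induction A, hA using Set.Finite.induction_on with
  | empty => exact mem_relBdries_empty c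
  | @insert a s has hs ih =>
    rw [Set.insert_eq]
    refine mem_relBdries_union isClosed_singleton hs.isClosed hk (h a (by simp))
      (ih fun x hx => h x (by simp [hx]))
      fun d _ _ => ?_
    rw [Set.singleton_inter_eq_empty.2 has]
    exact mem_relBdries_empty d

end Gluing

section Manifold

variable {n : ℕ} {N : Type*} [TopologicalSpace N] [T2Space N]

/-- On a manifold, relative cycles of degree at least the dimension that are locally trivial are
trivial. -/
theorem mem_relBdries_of_forall_mem [ChartedSpace (EuclideanSpace ℝ (Fin (n + 1))) N]
    {K : Set N} (hK : IsCompact K) {k : ℕ} (hk : n + 1 ≤ k)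
    {c : Chains N} (hck : c ∈ deg k) (hc : c ∈ relCycles K) (h : ∀ x ∈ K, c ∈ relBdries {x}) :
    c ∈ relBdries K := by
  refine GluingPrinciple.of_isCompact (n := n) (P := ℕ × Chains N)
    (compat := fun p K => n + 1 ≤ p.1 ∧ p.2 ∈ deg p.1 ∧ p.2 ∈ relCycles K ∧
      ∀ x ∈ K, p.2 ∈ relBdries {x})
    (Φ := fun p K => p.2 ∈ relBdries K) ?_ hK (p := (k, c)) ⟨hk, hck, hc, h⟩
  refine ⟨?_, ?_, ?_, ?_, ?_, ?_⟩
  · rintro p K L hLK ⟨h1, h2, h3, h4⟩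
    exact ⟨h1, h2, relCycles_anti hLK h3, fun x hx => h4 x (hLK hx)⟩
  · exact fun p K L hLK h => relBdries_anti hLK h
  · rintro ⟨k, c⟩ K L hK hL ⟨h1, h2, h3, h4⟩ hcK hcL hgood
    refine mem_relBdries_union hK.isClosed hL.isClosed h2 hcK hcL fun d hd hdc =>
      hgood (k + 1, d) ⟨Nat.le_succ_of_le h1, hd, hdc, fun x hx => ?_⟩
    exact mem_relBdries_singleton_of_ne (n := n) (by simp only at h1; omega) hd
      (relCycles_anti (Set.singleton_subset_iff.2 hx) hdc)
  · rintro p K - hp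
    obtain ⟨V, hV, hKV, h⟩ := exists_isOpen_mem_relBdries hp
    exact ⟨V, hV, hKV, fun L hL _ _ => relBdries_anti hL h⟩
  · exact fun p _ => mem_relBdries_empty _
  · exact fun p x h => h.2.2.2 x rfl

lemma mem_range_bd_of_forall_mem [ChartedSpace (EuclideanSpace ℝ (Fin (n + 1))) N]
    [CompactSpace N] {k : ℕ} (hk : n + 1 ≤ k) {c : Chains N}
    (hck : c ∈ deg k) (hc : bd c = 0) (h : ∀ x, c ∈ relBdries {x}) :
    c ∈ LinearMap.range bd := by
  have := mem_relBdries_of_forall_mem (n := n) isCompact_univ hk hck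
    (mem_relCycles_of_bd_eq_zero hc _) fun x _ => h x
  rwa [relBdries, Set.compl_univ, chainsIn_empty, sup_bot_eq] at this

end Manifold

section Finiteness

lemma exists_fg_forall_eq {M M' : Type*} [AddCommGroup M] [Module ℚ M] [AddCommGroup M']
    [Module ℚ M'] (φ : M →ₗ[ℚ] M') (Q : Submodule ℚ M) {F : Submodule ℚ M'} (hF : F.FG)
    (h : Q.map φ ≤ F) : ∃ Q' ≤ Q, Q'.FG ∧ ∀ x ∈ Q, ∃ y ∈ Q', φ x = φ y := by
  have : FiniteDimensional ℚ F := Module.Finite.iff_fg.2 hF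
  obtain ⟨s, hs⟩ : (Q.map φ).FG := Submodule.FG.of_le hF h
  have hsub : (s : Set M') ⊆ φ '' Q := by
    rw [← Submodule.map_coe, ← hs]
    exact Submodule.subset_span
  choose! g hgQ hg using hsub
  refine ⟨Submodule.span ℚ (g '' s), ?_, Submodule.fg_span (s.finite_toSet.image g), ?_⟩
  · rw [Submodule.span_le]
    exact Set.image_subset_iff.2 fun y hy => hgQ hy
  · intro x hx
    have hx' : φ x ∈ (Submodule.span ℚ (g '' s)).map φ := by
      rw [Submodule.map_span, Set.image_image, Set.image_congr fun y hy => hg hy, Set.image_id', hs]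
      exact Submodule.mem_map_of_mem hx
    obtain ⟨y, hy, h⟩ := hx'
    exact ⟨y, hy, h.symm⟩

variable {X : Type*} [TopologicalSpace X]

/-- The cycles in `V` span a finite-dimensional space modulo boundaries of chains in `U`. -/
def FiniteModBdries (V U : Set X) : Prop :=
  ∃ W : Submodule ℚ (Chains X), W.FG ∧ ∀ c ∈ chainsIn V, bd c = 0 → c ∈ W ⊔ (chainsIn U).map bd

lemma FiniteModBdries.union {V₁ V₂ V W₁ W₂ U : Set X} (hV₁ : IsOpen V₁) (hV₂ : IsOpen V₂)
    (hVW₁ : V₁ ⊆ W₁) (hVW₂ : V₂ ⊆ W₂) (hW₁ : W₁ ⊆ U) (hW₂ : W₂ ⊆ U) (hV : V₁ ∩ V₂ ⊆ V)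
    (h₁ : FiniteModBdries W₁ U) (h₂ : FiniteModBdries W₂ U) (h : FiniteModBdries V (W₁ ∩ W₂)) :
    FiniteModBdries (V₁ ∪ V₂) U := by
  obtain ⟨F₁, hF₁, h₁⟩ := h₁
  obtain ⟨F₂, hF₂, h₂⟩ := h₂
  obtain ⟨F, hF, h⟩ := h
  obtain ⟨Q, hmemQ⟩ : ∃ Q : Submodule ℚ (Chains X × Chains X), ∀ p q, (p, q) ∈ Q ↔
      ((p ∈ chainsIn W₁ ∧ q ∈ chainsIn W₂) ∧ bd p ∈ F) ∧ bd (p + q) = 0 :=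
    ⟨((chainsIn W₁).prod (chainsIn W₂)) ⊓ (F.comap (bd ∘ₗ LinearMap.fst ℚ _ _)) ⊓
      LinearMap.ker (bd ∘ₗ (LinearMap.fst ℚ _ _ + LinearMap.snd ℚ _ _)), fun p q => by
        simp only [Submodule.mem_inf, Submodule.mem_prod, Submodule.mem_comap, LinearMap.mem_ker,
          LinearMap.comp_apply, LinearMap.add_apply, LinearMap.fst_apply, LinearMap.snd_apply]⟩
  obtain ⟨Q', hQ'Q, hQ', hQ'e⟩ := exists_fg_forall_eq
    (bd ∘ₗ LinearMap.fst ℚ (Chains X) (Chains X)) Q hF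
    (Submodule.map_le_iff_le_comap.2 fun x hx => ((hmemQ x.1 x.2).1 hx).1.2)
  refine ⟨F₁ ⊔ F₂ ⊔ Q'.map (LinearMap.fst ℚ _ _ + LinearMap.snd ℚ _ _),
    (hF₁.sup hF₂).sup (hQ'.map _), fun c hc hbc => ?_⟩
  generalize hT : F₁ ⊔ F₂ ⊔ Q'.map (LinearMap.fst ℚ _ _ + LinearMap.snd ℚ _ _) ⊔
    (chainsIn U).map bd = T
  have hT1 : F₁ ⊔ (chainsIn U).map bd ≤ T :=
    hT ▸ sup_le_sup_right (le_sup_left.trans le_sup_left) _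
  have hT2 : F₂ ⊔ (chainsIn U).map bd ≤ T :=
    hT ▸ sup_le_sup_right (le_sup_right.trans le_sup_left) _
  have hT3 : (chainsIn U).map bd ≤ T := hT ▸ le_sup_right
  have hT4 : Q'.map (LinearMap.fst ℚ _ _ + LinearMap.snd ℚ _ _) ≤ T :=
    hT ▸ le_sup_right.trans le_sup_left
  obtain ⟨g, hg, u, hu, v, hv, rfl⟩ := exists_eq_bd_add_add hV₁ hV₂ hc (by
    rw [hbc]
    exact zero_mem _)
  rw [map_add, map_add, bd_bd, zero_add] at hbc
  have hbu := eq_neg_of_add_eq_zero_left hbc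
  obtain ⟨φ, hφ, _, ⟨k, hk, rfl⟩, hφk⟩ := Submodule.mem_sup.1 (h (bd u) (chainsIn_mono hV
    (mem_chainsIn_inter (bd_mem_chainsIn hu) (by
      rw [hbu]
      exact neg_mem (bd_mem_chainsIn hv)))) (bd_bd u))
  have hpq : (u - k, v + k) ∈ Q := by
    rw [hmemQ]
    refine ⟨⟨⟨sub_mem (chainsIn_mono hVW₁ hu) (chainsIn_mono Set.inter_subset_left hk),
      add_mem (chainsIn_mono hVW₂ hv) (chainsIn_mono Set.inter_subset_right hk)⟩, ?_⟩, ?_⟩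
    · rwa [map_sub, ← hφk, add_sub_cancel_right]
    · rw [show u - k + (v + k) = u + v by abel, map_add, hbc]
  obtain ⟨⟨p, q⟩, hpq', he⟩ := hQ'e _ hpq
  have hd := sub_mem hpq (hQ'Q hpq')
  rw [Prod.mk_sub_mk, hmemQ] at hd
  obtain ⟨⟨⟨hd1, hd2⟩, -⟩, hd3⟩ := hd
  have hp0 : bd (u - k - p) = 0 := by
    rw [map_sub, sub_eq_zero]
    exact he
  have hq0 : bd (v + k - q) = 0 := by
    rwa [map_add, hp0, zero_add] at hd3
  rw [show bd g + u + v = bd g + (u - k - p) + (v + k - q) + (p + q) by abel]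
  exact add_mem (add_mem (add_mem
    (hT3 ⟨g, chainsIn_mono (Set.union_subset (hVW₁.trans hW₁) (hVW₂.trans hW₂)) hg, rfl⟩)
    (hT1 (h₁ _ hd1 hp0))) (hT2 (h₂ _ hd2 hq0))) (hT4 ⟨(p, q), hpq', rfl⟩)

variable {n : ℕ} {N : Type*} [TopologicalSpace N] [T2Space N]

/-- The homology of a compact manifold is finite-dimensional. -/
theorem finiteModBdries_univ [ChartedSpace (EuclideanSpace ℝ (Fin (n + 1))) N]
    [CompactSpace N] :
    ∃ W : Submodule ℚ (Chains N), W.FG ∧ ∀ c, bd c = 0 → c ∈ W ⊔ LinearMap.range bd := by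
  suffices ∃ V : Set N, IsOpen V ∧ Set.univ ⊆ V ∧ V ⊆ Set.univ ∧ FiniteModBdries V Set.univ by
    obtain ⟨V, -, hV, -, W, hW, h⟩ := this
    refine ⟨W, hW, fun c hc => ?_⟩
    have := h c (chainsIn_mono hV (mem_chainsIn_univ c)) hc
    have hle : (chainsIn Set.univ).map bd ≤ LinearMap.range (bd (X := N)) := LinearMap.map_le_range
    exact sup_le_sup_left hle W this
  refine GluingPrinciple.of_isCompact (n := n) (P := Set N)
    (compat := fun U K => IsOpen U ∧ K ⊆ U)
    (Φ := fun U K => ∃ V, IsOpen V ∧ K ⊆ V ∧ V ⊆ U ∧ FiniteModBdries V U) ?_ isCompact_univ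
    ⟨isOpen_univ, subset_rfl⟩
  refine ⟨?_, ?_, ?_, ?_, ?_, ?_⟩
  · exact fun U K L hLK h => ⟨h.1, hLK.trans h.2⟩
  · exact fun U K L hLK ⟨V, hV, hKV, h⟩ => ⟨V, hV, hLK.trans hKV, h⟩
  · rintro U K L hK hL ⟨hU, -⟩ ⟨W₁, hW₁, hKW, hWU₁, h₁⟩ ⟨W₂, hW₂, hLW, hWU₂, h₂⟩ hgood
    obtain ⟨V, hV, hKLV, hVW, h⟩ := hgood (W₁ ∩ W₂) ⟨hW₁.inter hW₂, Set.inter_subset_inter hKW hLW⟩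
    obtain ⟨A, B, hA, hB, hKA, hLB, hAB⟩ := SeparatedNhds.of_isCompact_isCompact (hK.diff hV) hL
      (Set.disjoint_left.2 fun x hx hxL => hx.2 (hKLV ⟨hx.1, hxL⟩))
    refine ⟨(W₁ ∩ (A ∪ V)) ∪ (W₂ ∩ B), (hW₁.inter (hA.union hV)).union (hW₂.inter hB), ?_, ?_, ?_⟩
    · refine Set.union_subset_union (fun x hx => ⟨hKW hx, ?_⟩) (Set.subset_inter hLW hLB)
      by_cases hxV : x ∈ V
      · exact Or.inr hxV
      · exact Or.inl (hKA ⟨hx, hxV⟩)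
    · exact Set.union_subset (Set.inter_subset_left.trans hWU₁) (Set.inter_subset_left.trans hWU₂)
    · refine FiniteModBdries.union (hW₁.inter (hA.union hV)) (hW₂.inter hB) Set.inter_subset_left
        Set.inter_subset_left hWU₁ hWU₂ ?_ h₁ h₂ h
      rintro x ⟨⟨-, hx | hx⟩, -, hxB⟩
      · exact absurd hxB (Set.disjoint_left.1 hAB hx)
      · exact hx
  · exact fun U K _ ⟨V, hV, hKV, hVU, h⟩ => ⟨V, hV, hKV, fun L hL _ _ => ⟨V, hV, hL, hVU, h⟩⟩
  · refine fun U _ => ⟨∅, isOpen_empty, subset_rfl, Set.empty_subset _, ⊥, Submodule.fg_bot,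
      fun c hc _ => ?_⟩
    rw [chainsIn_empty, Submodule.mem_bot] at hc
    rw [hc]
    exact zero_mem _
  · rintro U x ⟨hU, hx⟩
    obtain ⟨f, hf, rfl, hfU⟩ := exists_isOpenEmbedding (n := n) hU (hx rfl)
    refine ⟨Set.range f, hf.isOpen_range, Set.singleton_subset_iff.2 ⟨0, rfl⟩, hfU,
      Submodule.span ℚ {push f (point 0)}, Submodule.fg_span_singleton _, fun c hc hbc => ?_⟩
    rw [← Set.image_univ] at hc
    obtain ⟨c, -, rfl⟩ := exists_push_eq hf.isEmbedding hc
    rw [bd_push, ← map_zero (push f)] at hbc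
    obtain ⟨e, -, he⟩ := exists_eq_bd_of_starConvex (starConvex_univ 0) (mem_chainsIn_univ c)
      (push_injective hf.injective hbc)
    rw [he, map_add, map_smul, add_comm (push f (bd e)), ← bd_push]
    exact Submodule.add_mem_sup (Submodule.smul_mem _ _ (Submodule.mem_span_singleton_self _))
      ⟨_, push_mem_chainsIn f (fun y _ => hfU ⟨y, rfl⟩) (mem_chainsIn_univ e), rfl⟩

end Finiteness

section Homology

variable {X : Type*} [TopologicalSpace X]

/-- The cycles of degree `k`. -/
noncomputable def cycles (X : Type*) [TopologicalSpace X] (k : ℕ) : Submodule ℚ (Chains X) :=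
  deg k ⊓ LinearMap.ker bd

/-- The homology of degree `k`. -/
abbrev Homology (X : Type*) [TopologicalSpace X] (k : ℕ) : Type _ :=
  cycles X k ⧸ (LinearMap.range bd).submoduleOf (cycles X k)

lemma finrank_moduleCat_homology (S : ShortComplex (ModuleCat.{0} ℚ)) {M : Type*} [AddCommGroup M]
    [Module ℚ M] (φ : S.X₂ →ₗ[ℚ] M) (hφ : Function.Injective φ) (Z B : Submodule ℚ M)
    (hZ : (LinearMap.ker S.g.hom).map φ = Z)
    (hB : ∀ z ∈ LinearMap.ker S.g.hom, φ z ∈ B ↔ z ∈ LinearMap.range S.f.hom) :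
    Module.finrank ℚ S.homology = Module.finrank ℚ (Z ⧸ B.submoduleOf Z) := by
  subst hZ
  rw [S.moduleCatHomologyIso.toLinearEquiv.finrank_eq]
  refine LinearEquiv.finrank_eq (Submodule.Quotient.equiv _ _
    ((LinearMap.ker S.g.hom).equivMapOfInjective φ hφ) ?_)
  ext y
  constructor
  · rintro ⟨_, ⟨x, rfl⟩, rfl⟩
    exact (hB _ (S.moduleCatToCycles x).2).2 ⟨x, rfl⟩
  · intro hy
    obtain ⟨z, rfl⟩ := ((LinearMap.ker S.g.hom).equivMapOfInjective φ hφ).surjective y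
    obtain ⟨x, hx⟩ := (hB _ z.2).1 hy
    exact ⟨z, ⟨x, Subtype.ext hx⟩, rfl⟩

end Homology

section Comparison

variable (X : Type) [TopologicalSpace X]

/-- The comparison map from Mathlib's singular chains. -/
noncomputable def comparison (k : ℕ) :
    ((singularChainComplex.obj (TopCat.of X)).X k) →ₗ[ℚ] Chains X :=
  Finsupp.lmapDomain ℚ ℚ fun s : (TopCat.toSSet.obj (TopCat.of X)).obj (.op (.mk k)) =>
    (⟨k, TopCat.toSSetObjEquiv (TopCat.of X) (.op (.mk k)) s⟩ : SingularSimplex X)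

lemma comparison_injective (k : ℕ) : Function.Injective (comparison X k) := by
  refine Finsupp.mapDomain_injective fun s t h => ?_
  exact (TopCat.toSSetObjEquiv (TopCat.of X) (.op (.mk k))).injective (eq_of_heq (Sigma.mk.inj h).2)

lemma range_comparison (k : ℕ) : LinearMap.range (comparison X k) = deg k := by
  refine (Submodule.map_top _).symm.trans ((congrArg _ Finsupp.supported_univ.symm).trans
    ((Finsupp.lmapDomain_supported ..).trans ?_))
  rw [deg, Set.image_univ]
  congr 1
  refine Set.Subset.antisymm (Set.range_subset_iff.2 fun s => rfl) ?_
  rintro ⟨_, σ⟩ rfl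
  exact ⟨(TopCat.toSSetObjEquiv (TopCat.of X) (.op (.mk _))).symm σ,
    congrArg _ (Equiv.apply_symm_apply _ _)⟩

lemma face_eq_map {k : ℕ} (i : Fin (k + 2)) (t : Simp k) :
    face i t = stdSimplex.map i.succAbove t := by
  ext j
  simp [face, affine_apply, FunOnFinite.linearMap_apply_apply, Pi.single_apply, Finset.sum_filter,
    eq_comm]

lemma map_alternating_sum {V W : ModuleCat.{0} ℚ} {M : Type*} [AddCommGroup M] [Module ℚ M]
    (φ : W →ₗ[ℚ] M) {l : ℕ} (g : Fin l → (V ⟶ W)) (x : V) :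
    φ ((∑ i : Fin l, (-1 : ℤ) ^ (i : ℕ) • g i).hom x) =
      ∑ i : Fin l, (-1 : ℚ) ^ (i : ℕ) • φ (g i x) := by
  rw [ModuleCat.hom_sum, LinearMap.sum_apply, map_sum]
  refine Finset.sum_congr rfl fun i _ => ?_
  rw [ModuleCat.hom_zsmul, LinearMap.smul_apply, map_zsmul, ← Int.cast_smul_eq_zsmul ℚ]
  push_cast
  rfl

lemma comparison_d (k : ℕ) (c : (singularChainComplex.obj (TopCat.of X)).X (k + 1)) :
    comparison X k ((singularChainComplex.obj (TopCat.of X)).d (k + 1) k c) =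
      bd (comparison X (k + 1) c) := by
  suffices h : comparison X k ∘ₗ ((singularChainComplex.obj (TopCat.of X)).d (k + 1) k).hom =
      bd ∘ₗ comparison X (k + 1) from LinearMap.congr_fun h c
  refine Finsupp.lhom_ext' fun s => LinearMap.ext_ring ?_
  have hd : (singularChainComplex.obj (TopCat.of X)).d (k + 1) k =
      ∑ i : Fin (k + 2), (-1 : ℤ) ^ (i : ℕ) •
        (ModuleCat.free ℚ).map ((TopCat.toSSet.obj (TopCat.of X)).δ i) :=
    AlternatingFaceMapComplex.obj_d_eq _ _
  have hs : comparison X (k + 1) (Finsupp.single s 1) = Finsupp.single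
      (⟨k + 1, TopCat.toSSetObjEquiv (TopCat.of X) (.op (.mk (k + 1))) s⟩ : SingularSimplex X) 1 :=
    Finsupp.mapDomain_single
  have hf : ∀ i : Fin (k + 2), comparison X k
      ((ModuleCat.free ℚ).map ((TopCat.toSSet.obj (TopCat.of X)).δ i) (Finsupp.single s 1)) =
      Finsupp.single (⟨k, (TopCat.toSSetObjEquiv (TopCat.of X) (.op (.mk (k + 1))) s).comp
        (face i)⟩ : SingularSimplex X) 1 := by
    intro i
    refine (congrArg (comparison X k) (ModuleCat.free_map_apply _ s)).trans ?_
    refine Finsupp.mapDomain_single.trans ?_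
    congr 2
    ext t
    refine (TopCat.toSSetObjEquiv_δ_apply s i t).trans ?_
    rw [← face_eq_map]
    rfl
  refine Eq.trans ?_ ((congrArg bd hs).trans (bd_single _)).symm
  refine (congrArg (fun g : (singularChainComplex.obj (TopCat.of X)).X (k + 1) ⟶
    (singularChainComplex.obj (TopCat.of X)).X k =>
      comparison X k (g.hom (Finsupp.single s 1))) hd).trans ?_
  exact (map_alternating_sum _ _ _).trans
    (Finset.sum_congr rfl fun i _ => congrArg _ (hf i))

theorem bettiNumber_eq (k : ℕ) :
    bettiNumber (TopCat.of X) (k + 1) = Module.finrank ℚ (Homology X (k + 1)) := by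
  let K := singularChainComplex.obj (TopCat.of X)
  let S := K.sc' (k + 2) (k + 1) k
  have e : K.homology (k + 1) ≅ S.homology :=
    ShortComplex.homologyMapIso (K.isoSc' (k + 2) (k + 1) k (by simp) (by simp))
  refine e.toLinearEquiv.finrank_eq.trans ?_
  refine finrank_moduleCat_homology S (comparison X (k + 1)) (comparison_injective X _) _ _ ?_ ?_
  · ext c
    constructor
    · rintro ⟨z, hz, rfl⟩
      refine ⟨range_comparison X (k + 1) ▸ ⟨z, rfl⟩, ?_⟩
      exact (comparison_d X k z).symm.trans ((congrArg _ hz).trans (map_zero _))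
    · rintro ⟨h1, h2⟩
      obtain ⟨z, rfl⟩ := (range_comparison X (k + 1)).ge h1
      exact ⟨z, comparison_injective X k ((comparison_d X k z).trans (h2.trans (map_zero _).symm)),
        rfl⟩
  · intro z hz
    constructor
    · rintro ⟨e, he⟩
      have : proj (k + 2) e ∈ deg (X := X) (k + 2) := proj_mem_deg _ _
      obtain ⟨w, hw⟩ := (range_comparison X (k + 2)).ge this
      refine ⟨w, comparison_injective X (k + 1) ((comparison_d X (k + 1) w).trans ?_)⟩
      rw [hw, bd_proj, he]
      exact proj_eq_self ((range_comparison X (k + 1)).le ⟨z, rfl⟩)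
    · rintro ⟨w, rfl⟩
      exact ⟨_, (comparison_d X _ w).symm⟩

end Comparison

section Homology

variable {X Y : Type*} [TopologicalSpace X] [TopologicalSpace Y]

lemma mem_cycles {k : ℕ} {c : Chains X} : c ∈ cycles X k ↔ c ∈ deg k ∧ bd c = 0 := Iff.rfl

lemma push_mem_cycles (f : C(X, Y)) {k : ℕ} {c : Chains X} (hc : c ∈ cycles X k) :
    push f c ∈ cycles Y k :=
  mem_cycles.2 ⟨push_mem_deg f hc.1, by rw [bd_push, (mem_cycles.1 hc).2, map_zero]⟩

/-- The homology class of a cycle. -/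
noncomputable def homologyClass (X : Type*) [TopologicalSpace X] (k : ℕ) : cycles X k →ₗ[ℚ] Homology X k :=
  Submodule.mkQ _

lemma homologyClass_surjective (k : ℕ) : Function.Surjective (homologyClass X k) :=
  Submodule.mkQ_surjective _

lemma homologyClass_eq_zero {k : ℕ} {c : cycles X k} :
    homologyClass X k c = 0 ↔ ∃ e, bd e = (c : Chains X) :=
  Submodule.Quotient.mk_eq_zero _

/-- The map on homology induced by a continuous map. -/
noncomputable def homologyMap (f : C(X, Y)) (k : ℕ) : Homology X k →ₗ[ℚ] Homology Y k :=
  Submodule.mapQ _ _ ((push f).restrict fun _ hc => push_mem_cycles f hc) <| by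
    rintro c ⟨e, he⟩
    exact ⟨push f e, (bd_push f e).trans (congrArg (push f) he)⟩

lemma homologyMap_homologyClass (f : C(X, Y)) {k : ℕ} (c : cycles X k) :
    homologyMap f k (homologyClass X k c) =
      homologyClass Y k ⟨push f c, push_mem_cycles f c.2⟩ := rfl

lemma finite_homology {W : Submodule ℚ (Chains X)} (hW : W.FG)
    (h : ∀ c, bd c = 0 → c ∈ W ⊔ LinearMap.range bd) (k : ℕ) :
    Module.Finite ℚ (Homology X k) := by
  let j : Homology X k →ₗ[ℚ] Chains X ⧸ LinearMap.range (bd (X := X)) :=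
    Submodule.mapQ _ _ (cycles X k).subtype le_rfl
  have hj : Function.Injective j := by
    rw [← LinearMap.ker_eq_bot]
    exact (Submodule.ker_mapQ _ _ _ _).trans (Submodule.mkQ_map_self _)
  have hjW : ∀ a, j a ∈ W.map (LinearMap.range (bd (X := X))).mkQ := by
    intro a
    obtain ⟨c, rfl⟩ := homologyClass_surjective k a
    obtain ⟨w, hw, b, hb, hwb⟩ := Submodule.mem_sup.1 (h c c.2.2)
    refine ⟨w, hw, ?_⟩
    refine ((Submodule.Quotient.eq _).2 ?_)
    rw [Submodule.subtype_apply, ← hwb, sub_add_cancel_left]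
    exact neg_mem hb
  have : Module.Finite ℚ (W.map (LinearMap.range (bd (X := X))).mkQ) :=
    Module.Finite.iff_fg.2 (hW.map _)
  exact Module.Finite.of_injective (j.codRestrict _ hjW) fun a b hab =>
    hj (congrArg Subtype.val hab)

lemma proj_push (f : C(X, Y)) (k : ℕ) (c : Chains X) : proj k (push f c) = push f (proj k c) := by
  suffices proj k ∘ₗ push f = push f ∘ₗ proj k from LinearMap.congr_fun this c
  refine Finsupp.lhom_ext' fun s => LinearMap.ext_ring ?_
  by_cases h : s.1 = k <;> simp [proj_single, h]

end Homology

section Complement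

variable {X : Type*} [TopologicalSpace X]

/-- The inclusion of the complement of a set. -/
def complIncl (A : Set X) : C(↥Aᶜ, X) := ⟨Subtype.val, continuous_subtype_val⟩

lemma complIncl_injective (A : Set X) : Function.Injective (push (complIncl A)) :=
  push_injective Subtype.val_injective

lemma push_complIncl_mem (A : Set X) (c : Chains ↥Aᶜ) : push (complIncl A) c ∈ chainsIn Aᶜ :=
  push_mem_chainsIn _ (fun x _ => x.2) (mem_chainsIn_univ c)

lemma exists_push_complIncl_eq {A : Set X} {c : Chains X} (hc : c ∈ chainsIn Aᶜ) :
    ∃ c' : Chains ↥Aᶜ, push (complIncl A) c' = c := by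
  obtain ⟨c', -, h⟩ := exists_push_eq (f := complIncl A) (A := Set.univ)
    Topology.IsEmbedding.subtypeVal (by
      rw [Set.image_univ]
      exact chainsIn_mono (B := Set.range (complIncl A)) (fun x hx => ⟨⟨x, hx⟩, rfl⟩) hc)
  exact ⟨c', h⟩

lemma exists_cycle_push_eq {A : Set X} {k : ℕ} {c : Chains X} (hc : c ∈ chainsIn Aᶜ)
    (hk : c ∈ cycles X k) : ∃ c' : cycles ↥Aᶜ k, push (complIncl A) c' = c := by
  obtain ⟨c', rfl⟩ := exists_push_complIncl_eq hc
  refine ⟨⟨c', ?_, ?_⟩, rfl⟩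
  · rw [← complIncl_injective A (by rw [← proj_push, proj_eq_self hk.1] :
      push (complIncl A) (proj k c') = push (complIncl A) c')]
    exact proj_mem_deg _ _
  · exact complIncl_injective A (by rw [← bd_push, map_zero]; exact hk.2)

lemma homologyMap_complIncl_surjective [T1Space X] {A : Set X} (hA : A.Finite) {k : ℕ}
    (h : ∀ x ∈ A, ∀ c ∈ cycles X k, c ∈ relBdries {x}) :
    Function.Surjective (homologyMap (complIncl A) k) := by
  intro a
  obtain ⟨c, rfl⟩ := homologyClass_surjective k a
  obtain ⟨e, -, s, hs, hsk, hc⟩ := exists_deg_of_mem_relBdries c.2.1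
    (mem_relBdries_of_finite hA c.2.1 fun x hx => h x hx c c.2)
  obtain ⟨s', rfl⟩ := exists_cycle_push_eq hs (mem_cycles.2 ⟨hsk, by
    have := (mem_cycles.1 c.2).2
    rwa [hc, map_add, bd_bd, zero_add] at this⟩)
  refine ⟨homologyClass _ _ s', ?_⟩
  rw [homologyMap_homologyClass, ← sub_eq_zero, ← map_sub, homologyClass_eq_zero]
  refine ⟨-e, ?_⟩
  rw [map_neg, Submodule.coe_sub, hc]
  abel

end Complement

section Complement

variable {X : Type*} [TopologicalSpace X]

/-- Relative cycles of degree `m` generating the local homology at the points of `A`. -/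
structure LocalGenerators (A : Set X) (m : ℕ) (z : A → Chains X) : Prop where
  mem_deg : ∀ x, z x ∈ deg m
  generates : ∀ x : A, Generates {(x : X)} (z x)
  relCycle : ∀ x, z x ∈ relCycles A
  relBdry_of_ne : ∀ x y : A, x ≠ y → z x ∈ relBdries {(y : X)}

variable {A : Set X} {m : ℕ} {z : A → Chains X} [Fintype A]

lemma LocalGenerators.sum_sub_mem (hz : LocalGenerators A m z) (a : A → ℚ) (x : A) :
    Fintype.linearCombination ℚ z a - a x • z x ∈ relBdries {(x : X)} := by
  classical
  rw [Fintype.linearCombination_apply, ← Finset.sum_erase_eq_sub (Finset.mem_univ x)]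
  exact Submodule.sum_mem _ fun y hy =>
    Submodule.smul_mem _ _ (hz.relBdry_of_ne y x (Finset.ne_of_mem_erase hy))

lemma LocalGenerators.sum_mem_deg (hz : LocalGenerators A m z) (a : A → ℚ) :
    Fintype.linearCombination ℚ z a ∈ deg m := by
  rw [Fintype.linearCombination_apply]
  exact Submodule.sum_mem _ fun y _ => Submodule.smul_mem _ _ (hz.mem_deg y)

lemma LocalGenerators.exists_coeff (hz : LocalGenerators A m z) {c : Chains X}
    (hc : c ∈ relCycles A) :
    ∃ a : A → ℚ, ∀ x : A, c - Fintype.linearCombination ℚ z a ∈ relBdries {(x : X)} := by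
  choose a ha using fun x : A => (hz.generates x).span c
    (relCycles_anti (Set.singleton_subset_iff.2 x.2) hc)
  refine ⟨a, fun x => ?_⟩
  rw [← sub_sub_sub_cancel_right c _ (a x • z x)]
  exact sub_mem (ha x) (hz.sum_sub_mem a x)

lemma LocalGenerators.eq_zero (hz : LocalGenerators A m z) {a : A → ℚ}
    (h : ∀ x : A, Fintype.linearCombination ℚ z a ∈ relBdries {(x : X)}) : a = 0 := by
  ext x
  by_contra hx
  refine (hz.generates x).not_mem ?_
  have := sub_mem (h x) (hz.sum_sub_mem a x)
  rw [sub_sub_cancel] at this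
  exact (Submodule.smul_mem_iff _ hx).1 this

/-- Boundaries of local generators, as cycles in the complement. -/
lemma LocalGenerators.exists_cycles {k : ℕ} (hz : LocalGenerators A (k + 1) z) :
    ∃ y : A → cycles ↥Aᶜ k, ∀ a : A → ℚ,
      push (complIncl A) (Fintype.linearCombination ℚ y a : cycles ↥Aᶜ k) =
        bd (Fintype.linearCombination ℚ z a) := by
  choose y hy using fun x => exists_cycle_push_eq (A := A) (k := k) (hz.relCycle x)
    ⟨bd_mem_deg (hz.mem_deg x), bd_bd _⟩
  refine ⟨y, fun a => ?_⟩
  simp [Fintype.linearCombination_apply, hy]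

/-- The kernel of the map on homology from the complement of a finite set is spanned by the
boundaries of local generators. -/
lemma LocalGenerators.ker_homologyMap [T1Space X] {k : ℕ} (hz : LocalGenerators A (k + 1) z)
    {y : A → cycles ↥Aᶜ k}
    (hy : ∀ a : A → ℚ, push (complIncl A) (Fintype.linearCombination ℚ y a : cycles ↥Aᶜ k) =
      bd (Fintype.linearCombination ℚ z a)) :
    LinearMap.ker (homologyMap (complIncl A) k) =
      LinearMap.range (homologyClass _ k ∘ₗ Fintype.linearCombination ℚ y) := by
  refine le_antisymm (fun c hc => ?_) ?_
  · obtain ⟨c, rfl⟩ := homologyClass_surjective k c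
    rw [LinearMap.mem_ker, homologyMap_homologyClass, homologyClass_eq_zero] at hc
    obtain ⟨e, he⟩ := hc
    replace he : bd (proj (k + 1) e) = push (complIncl A) c := by
      rw [bd_proj, he, proj_eq_self (push_mem_deg _ c.2.1)]
    obtain ⟨a, ha⟩ := hz.exists_coeff (c := proj (k + 1) e)
      (mem_relCycles.2 (by rw [he]; exact push_complIncl_mem A _))
    obtain ⟨f, s, hs, hfs⟩ := mem_relBdries.1 (mem_relBdries_of_finite A.toFinite
      (sub_mem (proj_mem_deg _ _) (hz.sum_mem_deg a)) fun x hx => ha ⟨x, hx⟩)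
    obtain ⟨s, rfl⟩ := exists_push_complIncl_eq hs
    refine ⟨a, ?_⟩
    rw [LinearMap.comp_apply, ← sub_eq_zero, ← map_sub, homologyClass_eq_zero]
    refine ⟨-s, complIncl_injective A ?_⟩
    rw [map_neg, map_neg, ← bd_push, Submodule.coe_sub, map_sub, hy, ← he, ← neg_sub, ← map_sub, hfs,
      map_add, bd_bd, zero_add]
  · rintro _ ⟨a, rfl⟩
    rw [LinearMap.mem_ker, LinearMap.comp_apply, homologyMap_homologyClass, homologyClass_eq_zero]
    exact ⟨_, (hy a).symm⟩

/-- If the top homology is spanned by a class that is locally nontrivial, the boundaries of local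
generators satisfy exactly one relation. -/
lemma LocalGenerators.finrank_ker [T1Space X] [Nonempty A] {k : ℕ}
    (hz : LocalGenerators A (k + 1) z) {y : A → cycles ↥Aᶜ k}
    (hy : ∀ a : A → ℚ, push (complIncl A) (Fintype.linearCombination ℚ y a : cycles ↥Aᶜ k) =
      bd (Fintype.linearCombination ℚ z a))
    {c₀ : Chains X} (hc₀ : c₀ ∈ cycles X (k + 1)) (hx₀ : ∀ x ∈ A, c₀ ∉ relBdries {x})
    (hspan : ∀ c ∈ cycles X (k + 1), ∃ q : ℚ, c - q • c₀ ∈ LinearMap.range bd) :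
    Module.finrank ℚ (LinearMap.ker (homologyClass _ k ∘ₗ Fintype.linearCombination ℚ y)) = 1 := by
  obtain ⟨a₀, ha₀⟩ := hz.exists_coeff (mem_relCycles_of_bd_eq_zero (mem_cycles.1 hc₀).2 A)
  have hne : a₀ ≠ 0 := by
    rintro rfl
    obtain ⟨x⟩ := ‹Nonempty A›
    refine hx₀ x x.2 ?_
    simpa using ha₀ x
  suffices LinearMap.ker (homologyClass _ k ∘ₗ Fintype.linearCombination ℚ y) =
      Submodule.span ℚ {a₀} by
    rw [this, finrank_span_singleton hne]
  refine le_antisymm (fun a ha => ?_) ?_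
  · rw [LinearMap.mem_ker, LinearMap.comp_apply, homologyClass_eq_zero] at ha
    obtain ⟨t, ht⟩ := ha
    replace ht : bd (proj (k + 1) t) = (Fintype.linearCombination ℚ y a : cycles ↥Aᶜ k) := by
      rw [bd_proj, ht, proj_eq_self (Fintype.linearCombination ℚ y a).2.1]
    obtain ⟨q, e, he⟩ := hspan
      (Fintype.linearCombination ℚ z a - push (complIncl A) (proj (k + 1) t))
      (mem_cycles.2 ⟨sub_mem (hz.sum_mem_deg a) (push_mem_deg _ (proj_mem_deg _ _)), by
        rw [map_sub, bd_push, ht, hy, sub_self]⟩)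
    refine Submodule.mem_span_singleton.2 ⟨q, ?_⟩
    rw [← sub_eq_zero]
    refine hz.eq_zero fun x => ?_
    rw [map_sub, map_smul, show q • Fintype.linearCombination ℚ z a₀ - Fintype.linearCombination ℚ z a
      = -(bd e + q • (c₀ - Fintype.linearCombination ℚ z a₀) +
        push (complIncl A) (proj (k + 1) t)) by rw [he, smul_sub]; abel]
    refine neg_mem (add_mem (add_mem (bd_mem_relBdries _ e) (Submodule.smul_mem _ _ (ha₀ x)))
      (chainsIn_le_relBdries _ (chainsIn_mono ?_ (push_complIncl_mem A _))))
    exact Set.compl_subset_compl.2 (Set.singleton_subset_iff.2 x.2)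
  · rw [Submodule.span_singleton_le_iff_mem, LinearMap.mem_ker, LinearMap.comp_apply,
      homologyClass_eq_zero]
    obtain ⟨f, s, hs, hfs⟩ := mem_relBdries.1 (mem_relBdries_of_finite A.toFinite
      (sub_mem hc₀.1 (hz.sum_mem_deg a₀)) fun x hx => ha₀ ⟨x, hx⟩)
    obtain ⟨s, rfl⟩ := exists_push_complIncl_eq hs
    have hbs := congrArg bd hfs
    rw [map_sub, map_add, bd_bd, zero_add, (mem_cycles.1 hc₀).2, zero_sub] at hbs
    refine ⟨-s, complIncl_injective A ?_⟩
    rw [hy, map_neg, map_neg, ← bd_push, ← hbs, neg_neg]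

end Complement

section Manifold

variable {n : ℕ} {N : Type*} [TopologicalSpace N] [T2Space N]

lemma exists_localGenerators [ChartedSpace (EuclideanSpace ℝ (Fin (n + 1))) N]
    {A : Set N} (hA : A.Finite) :
    ∃ z : A → Chains N, LocalGenerators A (n + 1) z := by
  choose z hzdeg hzU hz using fun x : A =>
    exists_generates_singleton (n := n) (N := N) (hA.subset (t := A \ {(x : N)})
      Set.sdiff_subset).isClosed.isOpen_compl (x := x) (by simp)
  refine ⟨z, hzdeg, hz, fun x => mem_relCycles.2 ?_, fun x y hxy => ?_⟩
  · refine chainsIn_mono ?_ (mem_chainsIn_inter (bd_mem_chainsIn (hzU x))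
      (mem_relCycles.1 (hz x).mem))
    rw [← Set.compl_union, Set.compl_subset_compl, Set.sdiff_union_self]
    exact Set.subset_union_left
  · refine chainsIn_le_relBdries _ (chainsIn_mono ?_ (hzU x))
    rw [Set.compl_subset_compl, Set.singleton_subset_iff]
    exact ⟨y.2, fun h => hxy (Subtype.ext h.symm)⟩

/-- The Betti numbers of the complement of a finite set, in terms of concrete homology. -/
theorem finrank_homology_compl [ChartedSpace (EuclideanSpace ℝ (Fin (n + 1))) N]
    [CompactSpace N] [ConnectedSpace N]
    (h : Module.finrank ℚ (Homology N (n + 1)) = 1) {A : Set N} (hA : A.Finite)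
    (hAne : A.Nonempty) :
    Module.finrank ℚ (Homology ↥Aᶜ n) + 1 =
      Module.finrank ℚ (Homology N n) + hA.toFinset.card := by
  have : Fintype A := hA.fintype
  have : Nonempty A := hAne.to_subtype
  obtain ⟨z, hz⟩ := exists_localGenerators (n := n) hA
  obtain ⟨y, hy⟩ := hz.exists_cycles
  obtain ⟨v, hv, hspan⟩ := finrank_eq_one_iff'.1 h
  obtain ⟨⟨c₀, hc₀⟩, rfl⟩ := homologyClass_surjective _ v
  have hker := hz.finrank_ker hy hc₀ (fun x _ hx => hv ?_) fun c hc => ?_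
  rotate_left
  · obtain ⟨e, he⟩ := mem_range_bd_of_forall_mem (n := n) le_rfl hc₀.1 (mem_cycles.1 hc₀).2
      (mem_relBdries_of_connected (n := n) (mem_cycles.1 hc₀).2 hx)
    exact homologyClass_eq_zero.2 ⟨e, he⟩
  · obtain ⟨q, hq⟩ := hspan (homologyClass _ _ ⟨c, hc⟩)
    refine ⟨q, ?_⟩
    rw [eq_comm, ← sub_eq_zero, ← map_smul, ← map_sub, homologyClass_eq_zero] at hq
    exact hq
  have hsurj : Function.Surjective (homologyMap (complIncl A) n) :=
    homologyMap_complIncl_surjective hA fun x _ c hc =>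
      mem_relBdries_singleton_of_ne (n := n) (by omega) hc.1
        (mem_relCycles_of_bd_eq_zero (mem_cycles.1 hc).2 _)
  have hk := hz.ker_homologyMap hy
  obtain ⟨W, hW, hWc⟩ := finiteModBdries_univ (n := n) (N := N)
  have := finite_homology hW hWc n
  have hfk : Module.Finite ℚ (LinearMap.ker (homologyMap (complIncl A) n)) := by
    rw [hk]
    infer_instance
  have : Module.Finite ℚ (Homology ↥Aᶜ n) := by
    refine ⟨Submodule.fg_of_fg_map_of_fg_inf_ker (homologyMap (complIncl A) n) ?_ ?_⟩
    · exact IsNoetherian.noetherian _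
    · rw [top_inf_eq]
      exact Module.Finite.iff_fg.1 hfk
  have h1 := LinearMap.finrank_range_add_finrank_ker (homologyMap (complIncl A) n)
  have h2 := LinearMap.finrank_range_add_finrank_ker
    (homologyClass _ n ∘ₗ Fintype.linearCombination ℚ y)
  rw [hker, ← hk, Module.finrank_fintype_fun_eq_card] at h2
  rw [LinearMap.range_eq_top.2 hsurj, finrank_top] at h1
  rw [hA.card_toFinset]
  omega

end Manifold

end SingularChains

/-- If `A` is a nonempty finite subset of a closed connected orientable
`(n+1)`-manifold `N` (orientability being encoded by the top rational Betti
number `β_{n+1}(N) = 1`), then `β_n(N ∖ A) = β_n(N) + |A| - 1`. -/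
theorem betti_of_complement_of_finite_set (n : ℕ) (hn : 1 ≤ n)
    (N : Type) [TopologicalSpace N] [T2Space N]
    [ChartedSpace (EuclideanSpace ℝ (Fin (n + 1))) N]
    [CompactSpace N] [ConnectedSpace N]
    (horient : bettiNumber (TopCat.of N) (n + 1) = 1)
    (A : Set N) (hA : A.Finite) (hAne : A.Nonempty) :
    bettiNumber (TopCat.of (↥Aᶜ)) n + 1 = bettiNumber (TopCat.of N) n + hA.toFinset.card := by
  obtain ⟨k, rfl⟩ := Nat.exists_eq_add_of_le' hn
  rw [SingularChains.bettiNumber_eq] at horient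
  rw [SingularChains.bettiNumber_eq, SingularChains.bettiNumber_eq]
  exact SingularChains.finrank_homology_compl horient hA hAne
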